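/- Let N ≥ 1, β ∈ LP_N, and j ∈ {1,…,2N−1} with {j,j+1} ∈ β. Fix the coordinates x_1 < ⋯ < x_{j−1} and x_{j+2} < ⋯ < x_{2N}, and let ξ ∈ (x_{j−1}, x_{j+2}). Then, as x_j, x_{j+1} → ξ, the quotient F_β(x_1,…,x_{2N}) / (x_{j+1} − x_j)^{1/4} converges to π · F_{β/{j,j+1}}(x_1,…,x_{j−1},x_{j+2},…,x_{2N}). -/

import Mathlib

open MeasureTheory

/-- A planar link pattern of size `N`: a noncrossing perfect matching of `{1,…,2N}`,
with the links `{a r, b r}` satisfying `a r < b r` and `a` strictly increasing. -/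
structure LinkPattern (N : ℕ) where
  a : Fin N → ℕ
  b : Fin N → ℕ
  a_lt_b : ∀ r, a r < b r
  a_mono : StrictMono a
  inj : Function.Injective (fun p : Fin N × Bool => if p.2 then b p.1 else a p.1)
  cover : ∀ k : ℕ, (∃ p : Fin N × Bool, (if p.2 then b p.1 else a p.1) = k) ↔ (1 ≤ k ∧ k ≤ 2 * N)
  noncross : ∀ r s : Fin N, ¬ (a r < a s ∧ a s < b r ∧ b r < b s)

/-- The (unordered) link relation of a link pattern. -/
def LinkPattern.Linked {N : ℕ} (β : LinkPattern N) (p q : ℕ) : Prop :=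
  ∃ r, (β.a r = p ∧ β.b r = q) ∨ (β.a r = q ∧ β.b r = p)

/-- The positive real integral `ρ_{k_1,…,k_N}(x)`. -/
noncomputable def rho (N : ℕ) (k : Fin N → ℕ) (x : ℕ → ℝ) : ℝ :=
  (∏ p ∈ (Finset.Icc 1 (2 * N) ×ˢ Finset.Icc 1 (2 * N)).filter fun p => p.1 < p.2,
      (x p.2 - x p.1) ^ ((4 : ℝ)⁻¹)) *
  ∫ u : Fin N → ℝ in Set.univ.pi fun r => Set.Ioo (x (k r)) (x (k r + 1)),
    (∏ p ∈ (Finset.univ ×ˢ Finset.univ : Finset (Fin N × Fin N)).filter fun p => p.1 < p.2,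
        (u p.2 - u p.1)) *
      ∏ r, ∏ i ∈ Finset.Icc 1 (2 * N), |u r - x i| ^ (-(2 : ℝ)⁻¹)

/-- The coefficient `c_β(k_1,…,k_N)`. -/
noncomputable def linkCoeff (N : ℕ) (β : LinkPattern N) (k : Fin N → ℕ) : ℂ :=
  Complex.I ^ ((∑ r, (k r : ℤ)) - ∑ r, (β.a r : ℤ)) *
    ∑ σ : Equiv.Perm (Fin N),
      ((Equiv.Perm.sign σ : ℤ) : ℂ) *
        ∏ r, if β.a r ≤ k (σ r) ∧ k (σ r) < β.b r then (1 : ℂ) else 0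

/-- The Coulomb gas integral `F_β(x)`. -/
noncomputable def coulomb (N : ℕ) (β : LinkPattern N) (x : ℕ → ℝ) : ℂ :=
  ∑ k ∈ (Fintype.piFinset fun _ : Fin N => Finset.Icc 1 (2 * N - 1)).filter
      fun k => ∀ r s : Fin N, r < s → k r < k s,
    linkCoeff N β k * (rho N k x : ℂ)

/-- Membership in the open chamber `𝔛_{2N}` (only coordinates `1,…,2N` are relevant). -/
def IsChamber (N : ℕ) (x : ℕ → ℝ) : Prop :=
  ∀ i k : ℕ, 1 ≤ i → i < k → k ≤ 2 * N → x i < x k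

/-- The relabeling map `{1,…,2N}∖{j,j+1} → {1,…,2N−2}`: `k ↦ k` for `k < j`, `k ↦ k−2` for `k > j+1`. -/
def relabelIdx (j k : ℕ) : ℕ := if k < j then k else k - 2

/-- `γ ∈ LP_{N−1}` is the pattern `β/{j,j+1}` obtained from `β ∈ LP_N` by deleting the link
`{j,j+1}` and relabeling the remaining indices in increasing order. -/
def IsReduction (N : ℕ) (β : LinkPattern N) (j : ℕ) (γ : LinkPattern (N - 1)) : Prop :=
  ∀ p q : ℕ, γ.Linked p q ↔
    ∃ p' q', β.Linked p' q' ∧ p' ≠ j ∧ p' ≠ j + 1 ∧ q' ≠ j ∧ q' ≠ j + 1 ∧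
      p = relabelIdx j p' ∧ q = relabelIdx j q'

/-- `δ ∈ LP_{N−1}` is the pattern `℘_j(β)/{j,j+1}` obtained from `β ∈ LP_N` (with `{j,j+1} ∉ β`,
partners `ℓ₁` of `j` and `ℓ₂` of `j+1`) by removing the links `{j,ℓ₁}`, `{j+1,ℓ₂}`, adding the
link `{ℓ₁,ℓ₂}`, removing the link `{j,j+1}` and relabeling the remaining indices. -/
def IsTieReduction (N : ℕ) (β : LinkPattern N) (j : ℕ) (δ : LinkPattern (N - 1)) : Prop :=
  ∃ l1 l2 : ℕ, β.Linked j l1 ∧ β.Linked (j + 1) l2 ∧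
    ∀ p q : ℕ, δ.Linked p q ↔
      ((∃ p' q', β.Linked p' q' ∧ p' ≠ j ∧ p' ≠ j + 1 ∧ q' ≠ j ∧ q' ≠ j + 1 ∧
          p = relabelIdx j p' ∧ q = relabelIdx j q') ∨
        (p = relabelIdx j l1 ∧ q = relabelIdx j l2) ∨
        (p = relabelIdx j l2 ∧ q = relabelIdx j l1))

section

open Filter Topology

/-- Cauchy–Binet, with the minors indexed by strictly increasing tuples. -/
theorem det_sum_mul_eq_sum_strictMono {N : ℕ} (S : Finset ℕ) (A : Fin N → ℕ → ℂ)
    (B : ℕ → Fin N → ℂ) :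
    (Matrix.of fun r m => ∑ k ∈ S, A r k * B k m).det =
      ∑ k ∈ (Fintype.piFinset fun _ : Fin N => S).filter
          fun k => ∀ r s : Fin N, r < s → k r < k s,
        (∑ σ : Equiv.Perm (Fin N), ((Equiv.Perm.sign σ : ℤ) : ℂ) * ∏ r, A r (k (σ r))) *
          (Matrix.of fun r m => B (k r) m).det := by
  classical
  have hexp : (Matrix.of fun r m => ∑ k ∈ S, A r k * B k m).det =
      ∑ f ∈ Fintype.piFinset fun _ : Fin N => S,
        (∏ r, A r (f r)) * (Matrix.of fun r m => B (f r) m).det := by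
    have h1 : (Matrix.of fun r m => ∑ k ∈ S, A r k * B k m) =
        fun r => ∑ k ∈ S, A r k • B k := by
      ext r m
      simp [Finset.sum_apply]
    have h2 := (Matrix.detRowAlternating (R := ℂ) (n := Fin N)).toMultilinearMap.map_sum_finset
      (fun r k => A r k • B k) (fun _ => S)
    have h3 : (Matrix.of fun r m => ∑ k ∈ S, A r k * B k m).det =
        Matrix.detRowAlternating (fun r => ∑ k ∈ S, A r k • B k) := by
      rw [h1]; rfl
    rw [h3]
    refine h2.trans (Finset.sum_congr rfl fun f _ => ?_)
    exact (Matrix.detRowAlternating (R := ℂ) (n := Fin N)).toMultilinearMap.map_smul_univ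
      (fun r => A r (f r)) (fun r => B (f r))
  have hinj : ∑ f ∈ Fintype.piFinset fun _ : Fin N => S,
        (∏ r, A r (f r)) * (Matrix.of fun r m => B (f r) m).det =
      ∑ f ∈ (Fintype.piFinset fun _ : Fin N => S).filter Function.Injective,
        (∏ r, A r (f r)) * (Matrix.of fun r m => B (f r) m).det := by
    refine (Finset.sum_filter_of_ne fun f _ hne => ?_).symm
    by_contra hf
    simp only [Function.Injective, not_forall] at hf
    obtain ⟨r, s, hrs, hne'⟩ := hf
    refine hne ?_
    rw [Matrix.det_zero_of_row_eq hne', mul_zero]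
    ext m
    simp [hrs]
  rw [hexp, hinj]
  simp_rw [Finset.sum_mul]
  rw [← Finset.sum_product']
  symm
  refine Finset.sum_bij (fun p _ => p.1 ∘ p.2) ?_ ?_ ?_ ?_
  · rintro ⟨k, σ⟩ h
    simp only [Finset.mem_product, Finset.mem_filter, Fintype.mem_piFinset, Finset.mem_univ,
      and_true] at h ⊢
    have hk : StrictMono k := fun r s => h.2 r s
    exact ⟨fun r => h.1 _, hk.injective.comp σ.injective⟩
  · rintro ⟨k, σ⟩ h ⟨k', σ'⟩ h' heq
    simp only [Finset.mem_product, Finset.mem_filter, Finset.mem_univ, and_true] at h h'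
    have hk : StrictMono k := fun r s => h.2 r s
    have hk' : StrictMono k' := fun r s => h'.2 r s
    have hkk : k = k' := by
      refine (hk.range_inj hk').1 ?_
      have := congrArg Set.range heq
      simpa [Set.range_comp] using this
    subst hkk
    have : σ = σ' := Equiv.ext fun r => hk.injective (congrFun heq r)
    rw [this]
  · intro f hf
    simp only [Finset.mem_filter, Fintype.mem_piFinset] at hf
    refine ⟨(f ∘ Tuple.sort f, (Tuple.sort f)⁻¹), ?_, ?_⟩
    · simp only [Finset.mem_product, Finset.mem_filter, Fintype.mem_piFinset, Finset.mem_univ,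
        and_true]
      exact ⟨fun r => hf.1 _, fun r s hrs => ((Tuple.monotone_sort f).strictMono_of_injective
        (hf.2.comp (Tuple.sort f).injective)) hrs⟩
    · ext r
      simp
  · rintro ⟨k, σ⟩ _
    have : (Matrix.of fun r m => B ((k ∘ σ) r) m) =
        (Matrix.of fun r m => B (k r) m).submatrix σ id := rfl
    simp only
    rw [this, Matrix.det_permute]
    simp only [Function.comp]
    ring

theorem hasDerivAt_arcsin_affine {c d u : ℝ} (hu : u ∈ Set.Ioo c d) :
    HasDerivAt (fun v => Real.arcsin ((2 * v - c - d) / (d - c)))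
      (|u - c| ^ (-(2 : ℝ)⁻¹) * |u - d| ^ (-(2 : ℝ)⁻¹)) u := by
  obtain ⟨hc, hd⟩ := hu
  have hcd : 0 < d - c := by linarith
  have h1 : 0 < u - c := by linarith
  have h2 : 0 < d - u := by linarith
  have hne1 : (2 * u - c - d) / (d - c) ≠ -1 := by
    rw [Ne, div_eq_iff hcd.ne']; intro h; linarith
  have hne2 : (2 * u - c - d) / (d - c) ≠ 1 := by
    rw [Ne, div_eq_iff hcd.ne']; intro h; linarith
  have hin : HasDerivAt (fun v : ℝ => (2 * v - c - d) / (d - c)) (2 * 1 / (d - c)) u :=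
    ((((hasDerivAt_id u).const_mul 2).sub_const c).sub_const d).div_const _
  have h := (Real.hasDerivAt_arcsin hne1 hne2).comp u hin
  refine h.congr_deriv ?_
  have hsq : 1 - ((2 * u - c - d) / (d - c)) ^ 2 =
      (2 / (d - c)) ^ 2 * ((u - c) * (d - u)) := by
    field_simp; ring
  have hsqrt : √(1 - ((2 * u - c - d) / (d - c)) ^ 2) =
      2 / (d - c) * (√(u - c) * √(d - u)) := by
    rw [hsq, Real.sqrt_mul (by positivity), Real.sqrt_sq (by positivity),
      Real.sqrt_mul h1.le]
  have e1 : |u - c| ^ (-(2 : ℝ)⁻¹) = (√(u - c))⁻¹ := by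
    rw [abs_of_pos h1, Real.rpow_neg h1.le, Real.sqrt_eq_rpow, one_div]
  have e2 : |u - d| ^ (-(2 : ℝ)⁻¹) = (√(d - u))⁻¹ := by
    rw [abs_sub_comm, abs_of_pos h2, Real.rpow_neg h2.le, Real.sqrt_eq_rpow, one_div]
  have p1 := Real.sqrt_pos.2 h1
  have p2 := Real.sqrt_pos.2 h2
  rw [hsqrt, e1, e2]
  field_simp

theorem continuousOn_arcsin_affine (c d : ℝ) :
    ContinuousOn (fun v => Real.arcsin ((2 * v - c - d) / (d - c))) (Set.Icc c d) := by
  fun_prop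

theorem integrableOn_arcsine (c d : ℝ) :
    IntegrableOn (fun u => |u - c| ^ (-(2 : ℝ)⁻¹) * |u - d| ^ (-(2 : ℝ)⁻¹)) (Set.Ioo c d) :=
  (intervalIntegral.integrableOn_deriv_of_nonneg (continuousOn_arcsin_affine c d)
    (fun _ hu => hasDerivAt_arcsin_affine hu) (fun _ _ => by positivity)).mono_set
    Set.Ioo_subset_Ioc_self

theorem setIntegral_arcsine {c d : ℝ} (h : c < d) :
    ∫ u in Set.Ioo c d, |u - c| ^ (-(2 : ℝ)⁻¹) * |u - d| ^ (-(2 : ℝ)⁻¹) = Real.pi := by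
  rw [← integral_Ioc_eq_integral_Ioo, ← intervalIntegral.integral_of_le h.le,
    intervalIntegral.integral_eq_sub_of_hasDerivAt_of_le h.le (continuousOn_arcsin_affine c d)
      (fun _ hu => hasDerivAt_arcsin_affine hu)
      ((intervalIntegrable_iff_integrableOn_Ioo_of_le h.le).2 (integrableOn_arcsine c d))]
  have hcd : d - c ≠ 0 := (sub_pos.2 h).ne'
  rw [show (2 * d - c - d) / (d - c) = 1 by field_simp; ring,
    show (2 * c - c - d) / (d - c) = -1 by field_simp; ring]
  simp

/-- The one-variable Coulomb gas weight. -/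
noncomputable def coulombWeight (N : ℕ) (x : ℕ → ℝ) (u : ℝ) : ℝ :=
  ∏ i ∈ Finset.Icc 1 (2 * N), |u - x i| ^ (-(2 : ℝ)⁻¹)

/-- The integral of `f` against the Coulomb gas weight between consecutive marked points. -/
noncomputable def cellIntegral (N : ℕ) (x : ℕ → ℝ) (k : ℕ) (f : ℝ → ℝ) : ℝ :=
  ∫ u in Set.Ioo (x k) (x (k + 1)), f u * coulombWeight N x u

/-- The distance from `x i` to the cell between `x k` and `x (k + 1)`. -/
noncomputable def cellDist (x : ℕ → ℝ) (k i : ℕ) : ℝ :=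
  if i < k then x k - x i else x i - x (k + 1)

theorem measurable_coulombWeight (N : ℕ) (x : ℕ → ℝ) : Measurable (coulombWeight N x) := by
  unfold coulombWeight
  fun_prop

theorem coulombWeight_nonneg (N : ℕ) (x : ℕ → ℝ) (u : ℝ) : 0 ≤ coulombWeight N x u :=
  Finset.prod_nonneg fun _ _ => by positivity

theorem cellDist_pos {N : ℕ} {x : ℕ → ℝ} (hx : IsChamber N x) {k : ℕ} (hk : k ∈ Finset.Icc 1 (2 * N - 1))
    {i : ℕ} (hi : i ∈ (Finset.Icc 1 (2 * N)) \ {k, k + 1}) : 0 < cellDist x k i := by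
  simp only [Finset.mem_sdiff, Finset.mem_Icc, Finset.mem_insert, Finset.mem_singleton] at hi hk
  unfold cellDist
  split_ifs with h
  · exact sub_pos.2 (hx _ _ (by omega) h (by omega))
  · exact sub_pos.2 (hx _ _ (by omega) (by omega) (by omega))

theorem coulombWeight_le {N : ℕ} {x : ℕ → ℝ} (hx : IsChamber N x) {k : ℕ}
    (hk : k ∈ Finset.Icc 1 (2 * N - 1)) {u : ℝ} (hu : u ∈ Set.Ioo (x k) (x (k + 1))) :
    coulombWeight N x u ≤ (|u - x k| ^ (-(2 : ℝ)⁻¹) * |u - x (k + 1)| ^ (-(2 : ℝ)⁻¹)) *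
      ∏ i ∈ (Finset.Icc 1 (2 * N)) \ {k, k + 1}, cellDist x k i ^ (-(2 : ℝ)⁻¹) := by
  have hsub : ({k, k + 1} : Finset ℕ) ⊆ Finset.Icc 1 (2 * N) := by
    intro i hi
    simp only [Finset.mem_Icc, Finset.mem_insert, Finset.mem_singleton] at hi hk ⊢
    omega
  unfold coulombWeight
  rw [← Finset.prod_sdiff hsub, Finset.prod_pair (by omega), mul_comm]
  refine mul_le_mul_of_nonneg_left (Finset.prod_le_prod (fun _ _ => by positivity) ?_)
    (by positivity)
  intro i hi
  refine Real.rpow_le_rpow_of_nonpos (cellDist_pos hx hk hi) ?_ (by norm_num)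
  simp only [Finset.mem_sdiff, Finset.mem_Icc, Finset.mem_insert, Finset.mem_singleton] at hi hk
  unfold cellDist
  split_ifs with h
  · exact le_trans (by linarith [hu.1]) (le_abs_self _)
  · exact le_trans (by linarith [hu.2]) (neg_le_abs _)

theorem norm_mul_coulombWeight_le {N : ℕ} {x : ℕ → ℝ} (hx : IsChamber N x) {k : ℕ}
    (hk : k ∈ Finset.Icc 1 (2 * N - 1)) {f : ℝ → ℝ} {F : ℝ}
    (hF : ∀ u ∈ Set.Ioo (x k) (x (k + 1)), |f u| ≤ F) {u : ℝ}
    (hu : u ∈ Set.Ioo (x k) (x (k + 1))) :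
    ‖f u * coulombWeight N x u‖ ≤
      (|u - x k| ^ (-(2 : ℝ)⁻¹) * |u - x (k + 1)| ^ (-(2 : ℝ)⁻¹)) *
      (F * ∏ i ∈ (Finset.Icc 1 (2 * N)) \ {k, k + 1}, cellDist x k i ^ (-(2 : ℝ)⁻¹)) := by
  have hF0 : 0 ≤ F := (abs_nonneg _).trans (hF u hu)
  rw [norm_mul, Real.norm_eq_abs, Real.norm_of_nonneg (coulombWeight_nonneg N x u)]
  calc _ ≤ F * _ := mul_le_mul (hF u hu) (coulombWeight_le hx hk hu)
        (coulombWeight_nonneg N x u) hF0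
    _ = _ := by ring

theorem integrableOn_mul_coulombWeight {N : ℕ} {x : ℕ → ℝ} (hx : IsChamber N x) {k : ℕ}
    (hk : k ∈ Finset.Icc 1 (2 * N - 1)) {f : ℝ → ℝ} (hf : Continuous f) :
    IntegrableOn (fun u => f u * coulombWeight N x u) (Set.Ioo (x k) (x (k + 1))) := by
  obtain ⟨F, hF⟩ := isCompact_Icc.exists_bound_of_continuousOn
    (s := Set.Icc (x k) (x (k + 1))) hf.continuousOn
  have hbound (u : ℝ) (hu : u ∈ Set.Ioo (x k) (x (k + 1))) :=
    norm_mul_coulombWeight_le hx hk (fun v hv => hF v (Set.Ioo_subset_Icc_self hv)) hu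
  exact ((integrableOn_arcsine (x k) (x (k + 1))).mul_const _).mono'
    (hf.measurable.mul (measurable_coulombWeight N x)).aestronglyMeasurable
    ((ae_restrict_mem measurableSet_Ioo).mono hbound)

theorem abs_cellIntegral_le {N : ℕ} {x : ℕ → ℝ} (hx : IsChamber N x) {k : ℕ}
    (hk : k ∈ Finset.Icc 1 (2 * N - 1)) {f : ℝ → ℝ} {F : ℝ}
    (hF : ∀ u ∈ Set.Ioo (x k) (x (k + 1)), |f u| ≤ F) :
    |cellIntegral N x k f| ≤ Real.pi *
      (F * ∏ i ∈ (Finset.Icc 1 (2 * N)) \ {k, k + 1}, cellDist x k i ^ (-(2 : ℝ)⁻¹)) := by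
  have hlt : x k < x (k + 1) := by
    simp only [Finset.mem_Icc] at hk
    exact hx _ _ hk.1 (by omega) (by omega)
  rw [← setIntegral_arcsine hlt, ← integral_mul_const]
  exact norm_integral_le_of_norm_le ((integrableOn_arcsine _ _).mul_const _)
    ((ae_restrict_mem measurableSet_Ioo).mono fun u hu => norm_mul_coulombWeight_le hx hk hF hu)

/-- The prefactor `∏_{i<k} (x_k - x_i)^{1/4}`. -/
noncomputable def gapProduct (N : ℕ) (x : ℕ → ℝ) : ℝ :=
  ∏ p ∈ (Finset.Icc 1 (2 * N) ×ˢ Finset.Icc 1 (2 * N)).filter fun p => p.1 < p.2,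
      (x p.2 - x p.1) ^ ((4 : ℝ)⁻¹)

theorem prod_filter_lt_eq_det_vandermonde {N : ℕ} (u : Fin N → ℝ) :
    ∏ p ∈ (Finset.univ ×ˢ Finset.univ : Finset (Fin N × Fin N)).filter fun p => p.1 < p.2,
        (u p.2 - u p.1) = (Matrix.vandermonde u).det := by
  rw [Matrix.det_vandermonde, Finset.prod_filter, Finset.prod_product]
  refine Finset.prod_congr rfl fun i _ => ?_
  rw [← Finset.prod_filter]
  refine Finset.prod_congr ?_ fun _ _ => rfl
  ext k
  simp

theorem rho_eq_det {N : ℕ} {x : ℕ → ℝ} (hx : IsChamber N x) (q : Fin N → Polynomial ℝ)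
    (hdeg : ∀ m, (q m).natDegree = m) (hmonic : ∀ m, (q m).Monic) {k : Fin N → ℕ}
    (hk : ∀ r, k r ∈ Finset.Icc 1 (2 * N - 1)) :
    rho N k x = gapProduct N x *
      (Matrix.of fun r m => cellIntegral N x (k r) fun u => (q m).eval u).det := by
  unfold rho gapProduct
  congr 1
  have hint (r m : Fin N) : Integrable (fun u => (q m).eval u * coulombWeight N x u)
      (volume.restrict (Set.Ioo (x (k r)) (x (k r + 1)))) :=
    integrableOn_mul_coulombWeight hx (hk r) (q m).continuous
  have hexp (u : Fin N → ℝ) :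
      (∏ p ∈ (Finset.univ ×ˢ Finset.univ : Finset (Fin N × Fin N)).filter fun p => p.1 < p.2,
        (u p.2 - u p.1)) * ∏ r, ∏ i ∈ Finset.Icc 1 (2 * N), |u r - x i| ^ (-(2 : ℝ)⁻¹) =
      ∑ σ : Equiv.Perm (Fin N), ((Equiv.Perm.sign σ : ℤ) : ℝ) *
        ∏ r, ((q (σ r)).eval (u r) * coulombWeight N x (u r)) := by
    rw [prod_filter_lt_eq_det_vandermonde,
      Matrix.det_eval_matrixOfPolynomials_eq_det_vandermonde u q hdeg hmonic,
      ← Matrix.det_transpose, Matrix.det_apply', Finset.sum_mul]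
    refine Finset.sum_congr rfl fun σ _ => ?_
    rw [mul_assoc, ← Finset.prod_mul_distrib]
    rfl
  simp_rw [hexp]
  rw [volume_pi, Measure.restrict_pi_pi, integral_finsetSum _ fun σ _ =>
    (Integrable.fintype_prod fun r => hint r (σ r)).const_mul _,
    ← Matrix.det_transpose, Matrix.det_apply']
  refine Finset.sum_congr rfl fun σ _ => ?_
  rw [integral_const_mul,
    integral_fintype_prod_eq_prod (fun r u => (q (σ r)).eval u * coulombWeight N x u)]
  rfl

theorem LinkPattern.one_le_a {N : ℕ} (β : LinkPattern N) (r : Fin N) : 1 ≤ β.a r :=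
  ((β.cover (β.a r)).1 ⟨(r, false), rfl⟩).1

theorem LinkPattern.b_le {N : ℕ} (β : LinkPattern N) (r : Fin N) : β.b r ≤ 2 * N :=
  ((β.cover (β.b r)).1 ⟨(r, true), rfl⟩).2

theorem LinkPattern.Ico_subset {N : ℕ} (β : LinkPattern N) (r : Fin N) :
    Finset.Ico (β.a r) (β.b r) ⊆ Finset.Icc 1 (2 * N - 1) := fun k hk => by
  have := β.one_le_a r
  have := β.b_le r
  simp only [Finset.mem_Ico, Finset.mem_Icc] at hk ⊢
  omega

/-- Determinantal form of the Coulomb gas integral. -/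
theorem coulomb_eq_det {N : ℕ} (β : LinkPattern N) {x : ℕ → ℝ} (hx : IsChamber N x)
    (q : Fin N → Polynomial ℝ) (hdeg : ∀ m, (q m).natDegree = m) (hmonic : ∀ m, (q m).Monic) :
    coulomb N β x = gapProduct N x * Complex.I ^ (-∑ r, (β.a r : ℤ)) *
      (Matrix.of fun r m => ∑ k ∈ Finset.Ico (β.a r) (β.b r),
        Complex.I ^ k * (cellIntegral N x k fun u => (q m).eval u : ℂ)).det := by
  have hM : (Matrix.of fun r m => ∑ k ∈ Finset.Ico (β.a r) (β.b r),
        Complex.I ^ k * (cellIntegral N x k fun u => (q m).eval u : ℂ)) =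
      Matrix.of fun r m => ∑ k ∈ Finset.Icc 1 (2 * N - 1),
        (if β.a r ≤ k ∧ k < β.b r then (1 : ℂ) else 0) *
        (Complex.I ^ k * (cellIntegral N x k fun u => (q m).eval u : ℂ)) := by
    ext r m
    simp only [Matrix.of_apply, ite_mul, one_mul, zero_mul]
    rw [← Finset.sum_filter]
    refine Finset.sum_congr ?_ fun _ _ => rfl
    ext k
    have : k ∈ Finset.Ico (β.a r) (β.b r) → _ := fun h => β.Ico_subset r h
    simp only [Finset.mem_Ico, Finset.mem_filter] at this ⊢
    tauto
  rw [hM, det_sum_mul_eq_sum_strictMono (Finset.Icc 1 (2 * N - 1)), coulomb, Finset.mul_sum]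
  refine Finset.sum_congr rfl fun k hk => ?_
  simp only [Finset.mem_filter, Fintype.mem_piFinset] at hk
  rw [rho_eq_det hx q hdeg hmonic hk.1, linkCoeff, zpow_sub₀ Complex.I_ne_zero, zpow_neg]
  have hdet : (Matrix.of fun r m =>
      Complex.I ^ k r * (cellIntegral N x (k r) fun u => (q m).eval u : ℂ)).det =
      Complex.I ^ (∑ r, (k r : ℤ)) *
        ((Matrix.of fun r m => cellIntegral N x (k r) fun u => (q m).eval u).det : ℝ) := by
    have h := Matrix.det_mul_column (fun r => Complex.I ^ k r)
      (Matrix.of fun r m => (cellIntegral N x (k r) fun u => (q m).eval u : ℂ))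
    refine h.trans ?_
    congr 1
    · rw [Finset.prod_pow_eq_pow_sum, ← zpow_natCast]
      push_cast
      rfl
    · exact (RingHom.map_det Complex.ofRealHom _).symm
  rw [hdet]
  push_cast
  ring

theorem relabelIdx_lt_iff {j p q : ℕ} (hp : p ≠ j) (hp' : p ≠ j + 1) (hq : q ≠ j)
    (hq' : q ≠ j + 1) : relabelIdx j p < relabelIdx j q ↔ p < q := by
  unfold relabelIdx
  split_ifs <;> omega

theorem relabelIdx_inj {j p q : ℕ} (hp : p ≠ j) (hp' : p ≠ j + 1) (hq : q ≠ j)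
    (hq' : q ≠ j + 1) (h : relabelIdx j p = relabelIdx j q) : p = q := by
  unfold relabelIdx at h
  split_ifs at h <;> omega

theorem LinkPattern.a_injective {N : ℕ} (β : LinkPattern N) : Function.Injective β.a :=
  β.a_mono.injective

theorem LinkPattern.a_ne_b {N : ℕ} (β : LinkPattern N) (r s : Fin N) : β.a r ≠ β.b s := fun h => by
  have := @β.inj (r, false) (s, true) (by simpa using h)
  simp at this

theorem LinkPattern.b_injective {N : ℕ} (β : LinkPattern N) : Function.Injective β.b :=
  fun r s h => by
    have := @β.inj (r, true) (s, true) (by simpa using h)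
    simpa using this

theorem LinkPattern.endpoints_ne {N : ℕ} (β : LinkPattern N) {j : ℕ} {r₀ r : Fin N}
    (ha : β.a r₀ = j) (hb : β.b r₀ = j + 1) (hr : r ≠ r₀) :
    β.a r ≠ j ∧ β.a r ≠ j + 1 ∧ β.b r ≠ j ∧ β.b r ≠ j + 1 :=
  ⟨fun h => hr (β.a_injective (h.trans ha.symm)), fun h => β.a_ne_b r r₀ (h.trans hb.symm),
    fun h => β.a_ne_b r₀ r (ha.trans h.symm), fun h => hr (β.b_injective (h.trans hb.symm))⟩

theorem IsReduction.a_eq {n : ℕ} {β : LinkPattern (n + 1)} {j : ℕ} {γ : LinkPattern n}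
    (hγ : IsReduction (n + 1) β j γ) {r₀ : Fin (n + 1)} (ha : β.a r₀ = j)
    (hb : β.b r₀ = j + 1) : γ.a = fun s => relabelIdx j (β.a (r₀.succAbove s)) := by
  have hne (s : Fin n) := β.endpoints_ne ha hb (r₀.succAbove_ne s)
  have hmono : StrictMono fun s => relabelIdx j (β.a (r₀.succAbove s)) := fun s s' hs =>
    (relabelIdx_lt_iff (hne s).1 (hne s).2.1 (hne s').1 (hne s').2.1).2
      (β.a_mono (Fin.strictMono_succAbove r₀ hs))
  refine (γ.a_mono.range_inj hmono).1 (Set.Subset.antisymm ?_ ?_)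
  · rintro _ ⟨s, rfl⟩
    obtain ⟨p', q', hL, hp1, hp2, hq1, hq2, hp, hq⟩ :=
      (hγ (γ.a s) (γ.b s)).1 ⟨s, Or.inl ⟨rfl, rfl⟩⟩
    have hlt : p' < q' := by
      rw [← relabelIdx_lt_iff hp1 hp2 hq1 hq2, ← hp, ← hq]
      exact γ.a_lt_b s
    obtain ⟨r, ⟨h1, h2⟩ | ⟨h1, h2⟩⟩ := hL
    · have hr : r ≠ r₀ := by rintro rfl; exact hp1 (h1.symm.trans ha)
      obtain ⟨s', rfl⟩ := Fin.exists_succAbove_eq hr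
      exact ⟨s', by simp only [h1, hp]⟩
    · have := β.a_lt_b r
      omega
  · rintro _ ⟨s, rfl⟩
    obtain ⟨h1, h2, h3, h4⟩ := hne s
    obtain ⟨s', ⟨h, _⟩ | ⟨h, h'⟩⟩ := (hγ _ _).2
      ⟨β.a (r₀.succAbove s), β.b (r₀.succAbove s), ⟨_, Or.inl ⟨rfl, rfl⟩⟩, h1, h2, h3, h4, rfl, rfl⟩
    · exact ⟨s', h⟩
    · have hlt := γ.a_lt_b s'
      rw [h, h', relabelIdx_lt_iff h3 h4 h1 h2] at hlt
      exact absurd hlt (β.a_lt_b _).le.not_gt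

theorem IsReduction.b_eq {n : ℕ} {β : LinkPattern (n + 1)} {j : ℕ} {γ : LinkPattern n}
    (hγ : IsReduction (n + 1) β j γ) {r₀ : Fin (n + 1)} (ha : β.a r₀ = j)
    (hb : β.b r₀ = j + 1) : γ.b = fun s => relabelIdx j (β.b (r₀.succAbove s)) := by
  have hne (s : Fin n) := β.endpoints_ne ha hb (r₀.succAbove_ne s)
  funext s
  obtain ⟨p', q', hL, hp1, hp2, hq1, hq2, hp, hq⟩ :=
    (hγ (γ.a s) (γ.b s)).1 ⟨s, Or.inl ⟨rfl, rfl⟩⟩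
  have hlt : p' < q' := by
    rw [← relabelIdx_lt_iff hp1 hp2 hq1 hq2, ← hp, ← hq]
    exact γ.a_lt_b s
  rw [hγ.a_eq ha hb] at hp
  have hp' := relabelIdx_inj (hne s).1 (hne s).2.1 hp1 hp2 hp
  obtain ⟨r, ⟨h1, h2⟩ | ⟨h1, h2⟩⟩ := hL
  · rw [hq, β.a_injective (hp'.trans h1.symm), h2]
  · have := β.a_lt_b r
    omega

/-- The order embedding of `{1,…,2N-2}` onto `{1,…,2N}∖{j,j+1}`. -/
def skipIdx (j i : ℕ) : ℕ := if i < j then i else i + 2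

/-- The marked points with `x_j` and `x_{j+1}` replaced by `s` and `t`. -/
noncomputable def movePair (x : ℕ → ℝ) (j : ℕ) (s t : ℝ) : ℕ → ℝ :=
  Function.update (Function.update x j s) (j + 1) t

/-- The marked points with `x_j` and `x_{j+1}` removed. -/
def dropPair (x : ℕ → ℝ) (j : ℕ) : ℕ → ℝ := fun i => if i < j then x i else x (i + 2)

theorem movePair_left (x : ℕ → ℝ) (j : ℕ) (s t : ℝ) : movePair x j s t j = s := by
  simp [movePair]

theorem movePair_right (x : ℕ → ℝ) (j : ℕ) (s t : ℝ) : movePair x j s t (j + 1) = t := by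
  simp [movePair]

theorem movePair_of_ne (x : ℕ → ℝ) {j i : ℕ} (s t : ℝ) (h : i ≠ j) (h' : i ≠ j + 1) :
    movePair x j s t i = x i := by
  simp [movePair, h, h']

theorem movePair_skipIdx (x : ℕ → ℝ) (j i : ℕ) (s t : ℝ) :
    movePair x j s t (skipIdx j i) = dropPair x j i := by
  unfold skipIdx dropPair
  split_ifs with h
  · exact movePair_of_ne x s t (by omega) (by omega)
  · exact movePair_of_ne x s t (by omega) (by omega)

theorem prod_Icc_eq_prod_skipIdx {M : Type*} [CommMonoid M] {n j : ℕ} (hj1 : 1 ≤ j)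
    (hj2 : j ≤ 2 * n + 1) (g : ℕ → M) :
    ∏ i ∈ Finset.Icc 1 (2 * (n + 1)), g i =
      g j * (g (j + 1) * ∏ i ∈ Finset.Icc 1 (2 * n), g (skipIdx j i)) := by
  have hinj : Set.InjOn (skipIdx j) (Finset.Icc 1 (2 * n)) := by
    intro p _ q _ h
    unfold skipIdx at h
    split_ifs at h <;> omega
  have hset : Finset.Icc 1 (2 * (n + 1)) =
      insert j (insert (j + 1) ((Finset.Icc 1 (2 * n)).image (skipIdx j))) := by
    ext i
    simp only [Finset.mem_Icc, Finset.mem_insert, Finset.mem_image]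
    constructor
    · intro hi
      by_cases h1 : i = j
      · exact Or.inl h1
      by_cases h2 : i = j + 1
      · exact Or.inr (Or.inl h2)
      refine Or.inr (Or.inr ⟨relabelIdx j i, ?_, ?_⟩)
      · unfold relabelIdx
        split_ifs <;> omega
      · unfold skipIdx relabelIdx
        split_ifs <;> omega
    · rintro (rfl | rfl | ⟨p, hp, rfl⟩)
      · omega
      · omega
      · unfold skipIdx
        split_ifs <;> omega
  rw [hset, Finset.prod_insert, Finset.prod_insert, Finset.prod_image hinj]
  · simp only [Finset.mem_image, not_exists, not_and, skipIdx]
    intro p _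
    split_ifs <;> omega
  · simp only [Finset.mem_insert, Finset.mem_image, not_or, not_exists, not_and, skipIdx]
    refine ⟨by omega, fun p _ => ?_⟩
    split_ifs <;> omega

theorem coulombWeight_movePair {n j : ℕ} (hj1 : 1 ≤ j) (hj2 : j ≤ 2 * n + 1) (x : ℕ → ℝ)
    (s t u : ℝ) : coulombWeight (n + 1) (movePair x j s t) u =
      |u - s| ^ (-(2 : ℝ)⁻¹) * |u - t| ^ (-(2 : ℝ)⁻¹) * coulombWeight n (dropPair x j) u := by
  unfold coulombWeight
  rw [prod_Icc_eq_prod_skipIdx hj1 hj2]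
  simp only [movePair_skipIdx, movePair_left, movePair_right, mul_assoc]

theorem gapProduct_eq_prod_prod (N : ℕ) (x : ℕ → ℝ) :
    gapProduct N x = ∏ i ∈ Finset.Icc 1 (2 * N), ∏ k ∈ Finset.Icc 1 (2 * N),
      if i < k then (x k - x i) ^ ((4 : ℝ)⁻¹) else 1 := by
  rw [gapProduct, Finset.prod_filter, Finset.prod_product]

theorem gapProduct_movePair {n j : ℕ} (hj1 : 1 ≤ j) (hj2 : j ≤ 2 * n + 1) {x : ℕ → ℝ}
    {s t : ℝ} (hx : IsChamber (n + 1) (movePair x j s t)) :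
    gapProduct (n + 1) (movePair x j s t) = (t - s) ^ ((4 : ℝ)⁻¹) *
      (∏ i ∈ Finset.Icc 1 (2 * n), |s - dropPair x j i| ^ ((4 : ℝ)⁻¹) *
        |t - dropPair x j i| ^ ((4 : ℝ)⁻¹)) * gapProduct n (dropPair x j) := by
  set z := movePair x j s t with hz
  have hleft (i : ℕ) (hi : i ∈ Finset.Icc 1 (2 * n)) (m : ℕ) (hm : m = j ∨ m = j + 1) :
      (if m < skipIdx j i then (z (skipIdx j i) - z m) ^ ((4 : ℝ)⁻¹) else 1) *
      (if skipIdx j i < m then (z m - z (skipIdx j i)) ^ ((4 : ℝ)⁻¹) else 1) =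
      |z m - dropPair x j i| ^ ((4 : ℝ)⁻¹) := by
    rw [← movePair_skipIdx x j i s t, ← hz]
    simp only [Finset.mem_Icc] at hi
    have hmem : 1 ≤ skipIdx j i ∧ skipIdx j i ≤ 2 * (n + 1) ∧ skipIdx j i ≠ m := by
      unfold skipIdx
      split_ifs <;> omega
    rcases lt_or_gt_of_ne hmem.2.2 with h | h
    · have := hx _ _ hmem.1 h (by omega)
      rw [if_neg h.not_gt, if_pos h, one_mul, abs_of_pos (sub_pos.2 this)]
    · have := hx _ _ (by omega) h hmem.2.1
      rw [if_neg h.not_gt, if_pos h, mul_one, abs_sub_comm, abs_of_pos (sub_pos.2 this)]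
  have hskip (i k : ℕ) : skipIdx j i < skipIdx j k ↔ i < k := by
    unfold skipIdx
    split_ifs <;> omega
  rw [gapProduct_eq_prod_prod, gapProduct_eq_prod_prod]
  simp only [prod_Icc_eq_prod_skipIdx hj1 hj2, lt_irrefl, if_false, one_mul,
    Nat.lt_succ_self, if_true, (Nat.lt_succ_self j).not_gt, Finset.prod_mul_distrib, hskip]
  have h1 := Finset.prod_congr (rfl : Finset.Icc 1 (2 * n) = _) fun i hi => hleft i hi j (Or.inl rfl)
  have h2 := Finset.prod_congr (rfl : Finset.Icc 1 (2 * n) = _)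
    fun i hi => hleft i hi (j + 1) (Or.inr rfl)
  rw [Finset.prod_mul_distrib, hz, movePair_left, ← hz] at h1
  rw [Finset.prod_mul_distrib, hz, movePair_right, ← hz] at h2
  rw [← h1, ← h2, hz, movePair_left, movePair_right, ← hz]
  simp only [hz, movePair_skipIdx]
  ring

/-- Arcsine laws on intervals shrinking to `ξ` converge to a point mass. -/
theorem tendsto_setIntegral_arcsine_mul {S : Set (ℝ × ℝ)} (hS : ∀ p ∈ S, p.1 < p.2) {ξ : ℝ}
    {g : ℝ → ℝ} (hg : ContinuousAt g ξ) (hm : Measurable g) :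
    Tendsto (fun p : ℝ × ℝ => ∫ u in Set.Ioo p.1 p.2,
      |u - p.1| ^ (-(2 : ℝ)⁻¹) * |u - p.2| ^ (-(2 : ℝ)⁻¹) * g u) (𝓝[S] (ξ, ξ))
      (𝓝 (Real.pi * g ξ)) := by
  rw [Metric.tendsto_nhds]
  intro η hη
  have hη' : 0 < η / (2 * Real.pi) := by positivity
  obtain ⟨δ, hδ, hδg⟩ := Metric.continuousAt_iff.1 hg _ hη'
  have hball : Metric.ball (ξ, ξ) δ ∈ 𝓝[S] ((ξ, ξ) : ℝ × ℝ) :=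
    mem_nhdsWithin_of_mem_nhds (Metric.ball_mem_nhds _ hδ)
  filter_upwards [hball, self_mem_nhdsWithin] with p hp hpS
  have hlt := hS p hpS
  rw [Metric.mem_ball, Prod.dist_eq, max_lt_iff, Real.dist_eq, Real.dist_eq, abs_lt, abs_lt] at hp
  have hclose (u : ℝ) (hu : u ∈ Set.Ioo p.1 p.2) : |g u - g ξ| ≤ η / (2 * Real.pi) := by
    refine (hδg ?_).le
    rw [Real.dist_eq, abs_lt]
    exact ⟨by linarith [hp.1.1, hu.1], by linarith [hp.2.2, hu.2]⟩
  have harc := integrableOn_arcsine p.1 p.2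
  have hbound : ∀ᵐ u ∂(volume.restrict (Set.Ioo p.1 p.2)),
      ‖|u - p.1| ^ (-(2 : ℝ)⁻¹) * |u - p.2| ^ (-(2 : ℝ)⁻¹) * (g u - g ξ)‖ ≤
        |u - p.1| ^ (-(2 : ℝ)⁻¹) * |u - p.2| ^ (-(2 : ℝ)⁻¹) * (η / (2 * Real.pi)) := by
    refine (ae_restrict_mem measurableSet_Ioo).mono fun u hu => ?_
    rw [norm_mul, Real.norm_of_nonneg (by positivity)]
    exact mul_le_mul_of_nonneg_left (hclose u hu) (by positivity)
  have hint : Integrable (fun u => |u - p.1| ^ (-(2 : ℝ)⁻¹) * |u - p.2| ^ (-(2 : ℝ)⁻¹) *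
      (g u - g ξ)) (volume.restrict (Set.Ioo p.1 p.2)) :=
    (harc.mul_const _).mono' (by fun_prop) hbound
  have hsplit : ∫ u in Set.Ioo p.1 p.2,
      |u - p.1| ^ (-(2 : ℝ)⁻¹) * |u - p.2| ^ (-(2 : ℝ)⁻¹) * g u =
      (∫ u in Set.Ioo p.1 p.2,
        |u - p.1| ^ (-(2 : ℝ)⁻¹) * |u - p.2| ^ (-(2 : ℝ)⁻¹) * (g u - g ξ)) + Real.pi * g ξ := by
    rw [← setIntegral_arcsine hlt, ← integral_mul_const, ← integral_add hint (harc.mul_const _)]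
    refine integral_congr_ae (Eventually.of_forall fun u => ?_)
    ring
  have hle := norm_integral_le_of_norm_le (harc.mul_const _) hbound
  rw [integral_mul_const, setIntegral_arcsine hlt, Real.norm_eq_abs] at hle
  rw [hsplit, Real.dist_eq, add_sub_cancel_right]
  refine hle.trans_lt ?_
  have : Real.pi * (η / (2 * Real.pi)) = η / 2 := by field_simp
  linarith

/-- Dominated convergence on intervals with moving endpoints. -/
theorem tendsto_setIntegral_Ioo_mul {α : Type*} {l : Filter α} [l.IsCountablyGenerated]
    {lo hi : α → ℝ} {a b A B c : ℝ} {φ : α → ℝ → ℝ} {h : ℝ → ℝ}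
    (hh : IntegrableOn h (Set.Ioo A B)) (hlo : Tendsto lo l (𝓝 a)) (hhi : Tendsto hi l (𝓝 b))
    (hA : A ≤ a) (hB : b ≤ B) (hAlo : ∀ᶠ p in l, A ≤ lo p) (hhiB : ∀ᶠ p in l, hi p ≤ B)
    (hm : ∀ p, Measurable (φ p))
    (hφ1 : ∀ᶠ p in l, ∀ u ∈ Set.Ioo (lo p) (hi p), |φ p u| ≤ 1)
    (hφ : ∀ u ∈ Set.Ioo a b, Tendsto (fun p => φ p u) l (𝓝 c)) :
    Tendsto (fun p => ∫ u in Set.Ioo (lo p) (hi p), φ p u * h u) l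
      (𝓝 (c * ∫ u in Set.Ioo a b, h u)) := by
  have hprod (s : Set ℝ) (hs : MeasurableSet s) (hsub : s ⊆ Set.Ioo A B) (ψ : ℝ → ℝ) :
      ∫ u in s, ψ u * h u = ∫ u, s.indicator ψ u * (Set.Ioo A B).indicator h u := by
    rw [← integral_indicator hs]
    congr 1
    funext u
    by_cases hu : u ∈ s
    · simp [hu, hsub hu]
    · simp [hu]
  rw [← integral_const_mul, hprod (Set.Ioo a b) measurableSet_Ioo (Set.Ioo_subset_Ioo hA hB)]
  have heq : (fun p => ∫ u, (Set.Ioo (lo p) (hi p)).indicator (φ p) u *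
      (Set.Ioo A B).indicator h u) =ᶠ[l] fun p => ∫ u in Set.Ioo (lo p) (hi p), φ p u * h u := by
    filter_upwards [hAlo, hhiB] with p h1 h2
    exact (hprod _ measurableSet_Ioo (Set.Ioo_subset_Ioo h1 h2) _).symm
  refine Tendsto.congr' heq ?_
  have hhI : Integrable ((Set.Ioo A B).indicator h) := hh.integrable_indicator measurableSet_Ioo
  refine tendsto_integral_filter_of_dominated_convergence
    (fun u => ‖(Set.Ioo A B).indicator h u‖) ?_ ?_ hhI.norm ?_
  · exact Eventually.of_forall fun p =>
      ((hm p).indicator measurableSet_Ioo).aestronglyMeasurable.mul hhI.aestronglyMeasurable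
  · filter_upwards [hφ1] with p hp
    refine Eventually.of_forall fun u => ?_
    rw [norm_mul]
    refine mul_le_of_le_one_left (norm_nonneg _) ?_
    by_cases hu : u ∈ Set.Ioo (lo p) (hi p)
    · simpa [hu] using hp u hu
    · simp [hu]
  · filter_upwards [compl_mem_ae_iff.2 (measure_singleton a),
      compl_mem_ae_iff.2 (measure_singleton b)] with u hua hub
    refine Tendsto.mul_const _ ?_
    rcases lt_or_gt_of_ne (show u ≠ a from hua) with h1 | h1
    · rw [Set.indicator_of_notMem fun hu => h1.not_gt hu.1]
      refine tendsto_const_nhds.congr' ?_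
      filter_upwards [hlo.eventually_const_lt h1] with p hp
      rw [Set.indicator_of_notMem fun hu => hp.not_gt hu.1]
    rcases lt_or_gt_of_ne (show u ≠ b from hub) with h2 | h2
    · rw [Set.indicator_of_mem (show u ∈ Set.Ioo a b from ⟨h1, h2⟩)]
      refine (hφ u ⟨h1, h2⟩).congr' ?_
      filter_upwards [hlo.eventually_lt_const h1, hhi.eventually_const_lt h2] with p hp hp'
      rw [Set.indicator_of_mem (show u ∈ Set.Ioo (lo p) (hi p) from ⟨hp, hp'⟩)]
    · rw [Set.indicator_of_notMem fun hu => h2.not_gt hu.2]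
      refine tendsto_const_nhds.congr' ?_
      filter_upwards [hhi.eventually_lt_const h2] with p hp
      rw [Set.indicator_of_notMem fun hu => hp.not_gt hu.2]

/-- The ordering assumptions for the collision of `x_j` and `x_{j+1}` at `ξ`. -/
structure PairCollision (n j : ℕ) (x : ℕ → ℝ) (ξ : ℝ) : Prop where
  one_le : 1 ≤ j
  le : j ≤ 2 * n + 1
  lt : ∀ i k : ℕ, 1 ≤ i → i < k → k ≤ 2 * (n + 1) →
    i ≠ j → i ≠ j + 1 → k ≠ j → k ≠ j + 1 → x i < x k
  lo : ∀ i : ℕ, 1 ≤ i → i < j → x i < ξ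
  hi : ∀ k : ℕ, j + 1 < k → k ≤ 2 * (n + 1) → ξ < x k

/-- The admissible positions of the pair `(x_j, x_{j+1})`. -/
def pairDomain (n j : ℕ) (x : ℕ → ℝ) : Set (ℝ × ℝ) :=
  {p : ℝ × ℝ | p.1 < p.2 ∧ (∀ i : ℕ, 1 ≤ i → i < j → x i < p.1) ∧
    ∀ k : ℕ, j + 1 < k → k ≤ 2 * (n + 1) → p.2 < x k}

namespace PairCollision

variable {n j : ℕ} {x : ℕ → ℝ} {ξ : ℝ}

theorem movePair_lt (h : PairCollision n j x ξ) {s t : ℝ}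
    (hlo : ∀ i : ℕ, 1 ≤ i → i < j → x i < s) (hst : s ≤ t)
    (hhi : ∀ k : ℕ, j + 1 < k → k ≤ 2 * (n + 1) → t < x k) {i k : ℕ} (hi : 1 ≤ i) (hik : i < k)
    (hk : k ≤ 2 * (n + 1)) (hne : ¬ (i = j ∧ k = j + 1)) :
    movePair x j s t i < movePair x j s t k := by
  by_cases h1 : i = j
  · subst h1
    rw [movePair_left, movePair_of_ne x s t (by omega) (by omega)]
    exact hst.trans_lt (hhi k (by omega) hk)
  by_cases h2 : i = j + 1
  · subst h2
    rw [movePair_right, movePair_of_ne x s t (by omega) (by omega)]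
    exact hhi k (by omega) hk
  rw [movePair_of_ne x s t h1 h2]
  by_cases h3 : k = j
  · subst h3
    rw [movePair_left]
    exact hlo i hi hik
  by_cases h4 : k = j + 1
  · subst h4
    rw [movePair_right]
    exact (hlo i hi (by omega)).trans_le hst
  rw [movePair_of_ne x s t h3 h4]
  exact h.lt i k hi hik hk h1 h2 h3 h4

theorem isChamber_movePair (h : PairCollision n j x ξ) {p : ℝ × ℝ} (hp : p ∈ pairDomain n j x) :
    IsChamber (n + 1) (movePair x j p.1 p.2) := fun i k hi hik hk => by
  by_cases hne : i = j ∧ k = j + 1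
  · rw [hne.1, hne.2, movePair_left, movePair_right]
    exact hp.1
  · exact h.movePair_lt hp.2.1 hp.1.le hp.2.2 hi hik hk hne

theorem movePair_self_lt (h : PairCollision n j x ξ) {i k : ℕ} (hi : 1 ≤ i) (hik : i < k)
    (hk : k ≤ 2 * (n + 1)) (hne : ¬ (i = j ∧ k = j + 1)) :
    movePair x j ξ ξ i < movePair x j ξ ξ k :=
  h.movePair_lt h.lo le_rfl h.hi hi hik hk hne

theorem isChamber_dropPair (h : PairCollision n j x ξ) : IsChamber n (dropPair x j) :=
  fun i k hi hik hk => by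
    rw [← movePair_skipIdx x j i ξ ξ, ← movePair_skipIdx x j k ξ ξ]
    unfold skipIdx
    split_ifs <;> exact h.movePair_self_lt (by omega) (by omega) (by omega) (by omega)

theorem ne_dropPair (h : PairCollision n j x ξ) {i : ℕ} (hi : i ∈ Finset.Icc 1 (2 * n)) :
    ξ - dropPair x j i ≠ 0 := by
  simp only [Finset.mem_Icc] at hi
  unfold dropPair
  split_ifs with hij
  · exact (sub_pos.2 (h.lo i hi.1 hij)).ne'
  · exact (sub_neg.2 (h.hi (i + 2) (by omega) (by omega))).ne

theorem tendsto_fst (n j : ℕ) (x : ℕ → ℝ) (ξ : ℝ) :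
    Tendsto Prod.fst (𝓝[pairDomain n j x] (ξ, ξ)) (𝓝 ξ) :=
  (continuous_fst.tendsto (ξ, ξ)).mono_left nhdsWithin_le_nhds

theorem tendsto_snd (n j : ℕ) (x : ℕ → ℝ) (ξ : ℝ) :
    Tendsto Prod.snd (𝓝[pairDomain n j x] (ξ, ξ)) (𝓝 ξ) :=
  (continuous_snd.tendsto (ξ, ξ)).mono_left nhdsWithin_le_nhds

theorem tendsto_movePair (n j : ℕ) (x : ℕ → ℝ) (ξ : ℝ) (i : ℕ) :
    Tendsto (fun p : ℝ × ℝ => movePair x j p.1 p.2 i) (𝓝[pairDomain n j x] (ξ, ξ))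
      (𝓝 (movePair x j ξ ξ i)) := by
  by_cases h1 : i = j
  · subst h1
    simpa only [movePair_left] using tendsto_fst n i x ξ
  by_cases h2 : i = j + 1
  · subst h2
    simpa only [movePair_right] using tendsto_snd n j x ξ
  simp only [movePair_of_ne x _ _ h1 h2]
  exact tendsto_const_nhds

theorem tendsto_gap_rpow (n j : ℕ) (x : ℕ → ℝ) (ξ : ℝ) {e : ℝ} (he : 0 < e) :
    Tendsto (fun p : ℝ × ℝ => (p.2 - p.1) ^ e) (𝓝[pairDomain n j x] (ξ, ξ)) (𝓝 0) := by
  have h := (tendsto_snd n j x ξ).sub (tendsto_fst n j x ξ)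
  rw [sub_self] at h
  simpa [Real.zero_rpow he.ne'] using h.rpow_const (Or.inr he.le)

theorem tendsto_gapProduct (h : PairCollision n j x ξ) :
    Tendsto (fun p : ℝ × ℝ => gapProduct (n + 1) (movePair x j p.1 p.2) /
      (p.2 - p.1) ^ ((4 : ℝ)⁻¹)) (𝓝[pairDomain n j x] (ξ, ξ))
      (𝓝 ((coulombWeight n (dropPair x j) ξ)⁻¹ * gapProduct n (dropPair x j))) := by
  have hlim : (coulombWeight n (dropPair x j) ξ)⁻¹ = ∏ i ∈ Finset.Icc 1 (2 * n),
      |ξ - dropPair x j i| ^ ((4 : ℝ)⁻¹) * |ξ - dropPair x j i| ^ ((4 : ℝ)⁻¹) := by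
    rw [coulombWeight, ← Finset.prod_inv_distrib]
    refine Finset.prod_congr rfl fun i hi => ?_
    have := abs_pos.2 (h.ne_dropPair hi)
    rw [← Real.rpow_add this, ← Real.rpow_neg this.le]
    norm_num
  have heq : (fun p : ℝ × ℝ => (∏ i ∈ Finset.Icc 1 (2 * n), |p.1 - dropPair x j i| ^ ((4 : ℝ)⁻¹) *
        |p.2 - dropPair x j i| ^ ((4 : ℝ)⁻¹)) * gapProduct n (dropPair x j))
      =ᶠ[𝓝[pairDomain n j x] (ξ, ξ)] fun p : ℝ × ℝ =>
        gapProduct (n + 1) (movePair x j p.1 p.2) / (p.2 - p.1) ^ ((4 : ℝ)⁻¹) := by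
    filter_upwards [self_mem_nhdsWithin] with p hp
    rw [gapProduct_movePair h.one_le h.le (h.isChamber_movePair hp)]
    have := Real.rpow_pos_of_pos (sub_pos.2 hp.1) (4 : ℝ)⁻¹
    rw [mul_assoc, mul_div_cancel_left₀ _ this.ne']
  refine Tendsto.congr' heq ?_
  rw [hlim]
  refine (tendsto_finsetProd _ fun i hi => ?_).mul_const _
  have hne := abs_ne_zero.2 (h.ne_dropPair hi)
  exact (((tendsto_fst n j x ξ).sub_const _).abs.rpow_const (Or.inl hne)).mul
    (((tendsto_snd n j x ξ).sub_const _).abs.rpow_const (Or.inl hne))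

theorem continuousAt_coulombWeight (h : PairCollision n j x ξ) :
    ContinuousAt (coulombWeight n (dropPair x j)) ξ := by
  unfold coulombWeight
  refine tendsto_finsetProd _ fun i hi => ?_
  exact (tendsto_id.sub_const _).abs.rpow_const (Or.inl (abs_ne_zero.2 (h.ne_dropPair hi)))

theorem cellIntegral_movePair_self (h : PairCollision n j x ξ) (s t : ℝ) (f : ℝ → ℝ) :
    cellIntegral (n + 1) (movePair x j s t) j f = ∫ u in Set.Ioo s t,
      |u - s| ^ (-(2 : ℝ)⁻¹) * |u - t| ^ (-(2 : ℝ)⁻¹) *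
        (f u * coulombWeight n (dropPair x j) u) := by
  rw [cellIntegral, movePair_left, movePair_right]
  refine integral_congr_ae (Eventually.of_forall fun u => ?_)
  simp only [coulombWeight_movePair h.one_le h.le]
  ring

theorem tendsto_cellIntegral_self (h : PairCollision n j x ξ) {f : ℝ → ℝ} (hf : Continuous f) :
    Tendsto (fun p : ℝ × ℝ => cellIntegral (n + 1) (movePair x j p.1 p.2) j f)
      (𝓝[pairDomain n j x] (ξ, ξ)) (𝓝 (Real.pi * (f ξ * coulombWeight n (dropPair x j) ξ))) := by
  simp only [h.cellIntegral_movePair_self]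
  exact tendsto_setIntegral_arcsine_mul (fun p hp => hp.1)
    (hf.continuousAt.mul h.continuousAt_coulombWeight)
    (hf.measurable.mul (measurable_coulombWeight _ _))

theorem tendsto_cellIntegral_self_sub (h : PairCollision n j x ξ) {f : ℝ → ℝ}
    (hf : Continuous f) :
    Tendsto (fun p : ℝ × ℝ => (p.2 - p.1) ^ (-(3 / 4) : ℝ) *
      cellIntegral (n + 1) (movePair x j p.1 p.2) j fun u => (u - p.1) * f u)
      (𝓝[pairDomain n j x] (ξ, ξ)) (𝓝 0) := by
  set g : ℝ → ℝ := fun u => f u * coulombWeight n (dropPair x j) u with hgdef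
  have hg : ContinuousAt g ξ := hf.continuousAt.mul h.continuousAt_coulombWeight
  obtain ⟨δ, hδ, hδg⟩ := Metric.continuousAt_iff.1 hg 1 one_pos
  have hlim := (tendsto_gap_rpow n j x ξ (e := 1 / 4) (by norm_num)).mul_const
    (Real.pi * (|g ξ| + 1))
  rw [zero_mul] at hlim
  refine squeeze_zero_norm' ?_ hlim
  have hball : Metric.ball (ξ, ξ) δ ∈ 𝓝[pairDomain n j x] ((ξ, ξ) : ℝ × ℝ) :=
    mem_nhdsWithin_of_mem_nhds (Metric.ball_mem_nhds _ hδ)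
  filter_upwards [hball, self_mem_nhdsWithin] with p hp hpS
  rw [Metric.mem_ball, Prod.dist_eq, max_lt_iff, Real.dist_eq, Real.dist_eq, abs_lt, abs_lt] at hp
  have hpos : 0 < p.2 - p.1 := sub_pos.2 hpS.1
  have hbound : ∀ᵐ u ∂(volume.restrict (Set.Ioo p.1 p.2)),
      ‖|u - p.1| ^ (-(2 : ℝ)⁻¹) * |u - p.2| ^ (-(2 : ℝ)⁻¹) *
        ((u - p.1) * f u * coulombWeight n (dropPair x j) u)‖ ≤
        |u - p.1| ^ (-(2 : ℝ)⁻¹) * |u - p.2| ^ (-(2 : ℝ)⁻¹) *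
          ((p.2 - p.1) * (|g ξ| + 1)) := by
    refine (ae_restrict_mem measurableSet_Ioo).mono fun u hu => ?_
    rw [norm_mul, Real.norm_of_nonneg (by positivity), mul_assoc (u - p.1), norm_mul]
    refine mul_le_mul_of_nonneg_left (mul_le_mul ?_ ?_ (norm_nonneg _) hpos.le) (by positivity)
    · rw [Real.norm_of_nonneg (by linarith [hu.1])]
      linarith [hu.2]
    · have hd : |g u - g ξ| < 1 := by
        refine hδg ?_
        rw [Real.dist_eq, abs_lt]
        exact ⟨by linarith [hp.1.1, hu.1], by linarith [hp.2.2, hu.2]⟩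
      have := abs_sub_abs_le_abs_sub (g u) (g ξ)
      change |g u| ≤ _
      linarith
  have hle := norm_integral_le_of_norm_le ((integrableOn_arcsine p.1 p.2).mul_const _) hbound
  rw [integral_mul_const, setIntegral_arcsine hpS.1] at hle
  rw [h.cellIntegral_movePair_self, norm_mul,
    Real.norm_of_nonneg (Real.rpow_nonneg hpos.le _)]
  calc _ ≤ (p.2 - p.1) ^ (-(3 / 4) : ℝ) * (Real.pi * ((p.2 - p.1) * (|g ξ| + 1))) :=
        mul_le_mul_of_nonneg_left hle (Real.rpow_nonneg hpos.le _)
    _ = ((p.2 - p.1) ^ (-(3 / 4) : ℝ) * (p.2 - p.1) ^ (1 : ℝ)) * (Real.pi * (|g ξ| + 1)) := by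
        rw [Real.rpow_one]; ring
    _ = _ := by
        rw [← Real.rpow_add hpos]
        norm_num

theorem tendsto_gap_mul_cellIntegral (h : PairCollision n j x ξ) {f : ℝ → ℝ}
    (hf : Continuous f) {k : ℕ} (hk : k ∈ Finset.Icc 1 (2 * n + 1)) (hkj : k ≠ j) :
    Tendsto (fun p : ℝ × ℝ => (p.2 - p.1) ^ (3 / 4 : ℝ) *
      cellIntegral (n + 1) (movePair x j p.1 p.2) k f)
      (𝓝[pairDomain n j x] (ξ, ξ)) (𝓝 0) := by
  have hj := h.one_le
  have hj' := h.le
  have hk' : k ∈ Finset.Icc 1 (2 * (n + 1) - 1) := by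
    simp only [Finset.mem_Icc] at hk ⊢
    omega
  simp only [Finset.mem_Icc] at hk
  set z := movePair x j ξ ξ with hz
  obtain ⟨F, hF⟩ := isCompact_Icc.exists_bound_of_continuousOn
    (s := Set.Icc (z k - 1) (z (k + 1) + 1)) hf.continuousOn
  have hF0 : 0 ≤ F := by
    have hzk : z k < z (k + 1) := h.movePair_self_lt hk.1 (by omega) (by omega) (by omega)
    exact (norm_nonneg _).trans (hF (z k) ⟨by linarith, by linarith⟩)
  set o := if k < j then j + 1 else j with ho
  set S := (Finset.Icc 1 (2 * (n + 1))) \ {k, k + 1} with hS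
  have hoS : o ∈ S := by
    simp only [hS, ho, Finset.mem_sdiff, Finset.mem_Icc, Finset.mem_insert, Finset.mem_singleton]
    split_ifs <;> omega
  have hdist : Tendsto (fun p : ℝ × ℝ =>
      ∏ i ∈ S.erase o, cellDist (movePair x j p.1 p.2) k i ^ (-(2 : ℝ)⁻¹))
      (𝓝[pairDomain n j x] (ξ, ξ)) (𝓝 (∏ i ∈ S.erase o, cellDist z k i ^ (-(2 : ℝ)⁻¹))) := by
    refine tendsto_finsetProd _ fun i hi => ?_
    simp only [hS, ho, Finset.mem_erase, Finset.mem_sdiff, Finset.mem_Icc, Finset.mem_insert,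
      Finset.mem_singleton] at hi
    unfold cellDist
    by_cases hik : i < k
    · simp only [if_pos hik]
      refine ((tendsto_movePair n j x ξ k).sub (tendsto_movePair n j x ξ i)).rpow_const
        (Or.inl (sub_pos.2 (h.movePair_self_lt hi.2.1.1 hik (by omega) ?_)).ne')
      rintro ⟨rfl, rfl⟩
      simp at hi
    · simp only [if_neg hik]
      refine ((tendsto_movePair n j x ξ i).sub (tendsto_movePair n j x ξ (k + 1))).rpow_const
        (Or.inl (sub_pos.2 (h.movePair_self_lt (by omega) (by omega) hi.2.1.2 ?_)).ne')
      rintro ⟨h1, rfl⟩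
      rw [if_pos (by omega)] at hi
      exact hi.1 rfl
  have hlim := (tendsto_gap_rpow n j x ξ (e := 1 / 4) (by norm_num)).mul
    ((hdist.const_mul F).const_mul Real.pi)
  rw [zero_mul] at hlim
  refine squeeze_zero_norm' ?_ hlim
  filter_upwards [self_mem_nhdsWithin,
    (tendsto_movePair n j x ξ k).eventually_const_lt (show z k - 1 < z k by linarith),
    (tendsto_movePair n j x ξ (k + 1)).eventually_lt_const
      (show z (k + 1) < z (k + 1) + 1 by linarith)] with p hp hlo hhi
  have hc := h.isChamber_movePair hp
  have hpos : 0 < p.2 - p.1 := sub_pos.2 hp.1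
  have hle := abs_cellIntegral_le hc hk' (f := f) (F := F)
    fun u hu => hF u ⟨(hlo.trans hu.1).le, (hu.2.trans hhi).le⟩
  rw [← hS, ← Finset.mul_prod_erase S _ hoS] at hle
  have hgap : p.2 - p.1 ≤ cellDist (movePair x j p.1 p.2) k o := by
    have hmono (a b : ℕ) (ha : 1 ≤ a) (hab : a ≤ b) (hb : b ≤ 2 * (n + 1)) :
        movePair x j p.1 p.2 a ≤ movePair x j p.1 p.2 b := by
      rcases hab.eq_or_lt with rfl | hab
      · exact le_rfl
      · exact (hc a b ha hab hb).le
    unfold cellDist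
    by_cases hlt : k < j
    · have := hmono (k + 1) j (by omega) (by omega) (by omega)
      rw [movePair_left] at this
      rw [ho, if_pos hlt, if_neg (by omega), movePair_right]
      linarith
    · have := hmono (j + 1) k (by omega) (by omega) (by omega)
      rw [movePair_right] at this
      rw [ho, if_neg hlt, if_pos (by omega), movePair_left]
      linarith
  have hpow := Real.rpow_le_rpow_of_nonpos hpos hgap (z := -(2 : ℝ)⁻¹) (by norm_num)
  have hprod : 0 ≤ ∏ i ∈ S.erase o, cellDist (movePair x j p.1 p.2) k i ^ (-(2 : ℝ)⁻¹) :=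
    Finset.prod_nonneg fun i hi =>
      Real.rpow_nonneg (cellDist_pos hc hk' (Finset.mem_of_mem_erase hi)).le _
  rw [norm_mul, Real.norm_of_nonneg (Real.rpow_nonneg hpos.le _), Real.norm_eq_abs]
  set P := ∏ i ∈ S.erase o, cellDist (movePair x j p.1 p.2) k i ^ (-(2 : ℝ)⁻¹)
  calc _ ≤ (p.2 - p.1) ^ (3 / 4 : ℝ) *
          (Real.pi * (F * ((p.2 - p.1) ^ (-(2 : ℝ)⁻¹) * P))) := by
        refine mul_le_mul_of_nonneg_left (hle.trans ?_) (Real.rpow_nonneg hpos.le _)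
        gcongr
    _ = ((p.2 - p.1) ^ (3 / 4 : ℝ) * (p.2 - p.1) ^ (-(2 : ℝ)⁻¹)) * (Real.pi * (F * P)) := by ring
    _ = _ := by
        rw [← Real.rpow_add hpos]
        norm_num

theorem abs_collapse_le_one {a b : ℝ} (h0 : a ≠ 0) (hab : |a| ≤ |b|) :
    |a * (|a| ^ (-(2 : ℝ)⁻¹) * |b| ^ (-(2 : ℝ)⁻¹))| ≤ 1 := by
  have ha : 0 < |a| := abs_pos.2 h0
  have hpow := Real.rpow_le_rpow_of_nonpos ha hab (z := -(2 : ℝ)⁻¹) (by norm_num)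
  rw [abs_mul, abs_of_nonneg (a := _ * _) (by positivity)]
  calc _ ≤ |a| * (|a| ^ (-(2 : ℝ)⁻¹) * |a| ^ (-(2 : ℝ)⁻¹)) := by gcongr
    _ = 1 := by
      rw [← Real.rpow_add ha]
      norm_num [Real.rpow_neg_one, ha.ne']

theorem tendsto_collapse {α : Type*} {l : Filter α} {f g : α → ℝ} {a : ℝ} (ha : a ≠ 0)
    (hf : Tendsto f l (𝓝 a)) (hg : Tendsto g l (𝓝 a)) :
    Tendsto (fun p => f p * (|f p| ^ (-(2 : ℝ)⁻¹) * |g p| ^ (-(2 : ℝ)⁻¹))) l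
      (𝓝 (a / |a|)) := by
  have h0 := abs_ne_zero.2 ha
  have h := hf.mul ((hf.abs.rpow_const (p := -(2 : ℝ)⁻¹) (Or.inl h0)).mul
    (hg.abs.rpow_const (p := -(2 : ℝ)⁻¹) (Or.inl h0)))
  rw [← Real.rpow_add (abs_pos.2 ha)] at h
  convert h using 2
  norm_num [Real.rpow_neg_one, div_eq_mul_inv]

theorem tendsto_cellIntegral_of_lt (h : PairCollision n j x ξ) {f : ℝ → ℝ} (hf : Continuous f)
    {k : ℕ} (hk1 : 1 ≤ k) (hkj : k < j) (hk : k + 1 < j ∨ j ≤ 2 * n) :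
    Tendsto (fun p : ℝ × ℝ =>
      cellIntegral (n + 1) (movePair x j p.1 p.2) k fun u => (u - p.1) * f u)
      (𝓝[pairDomain n j x] (ξ, ξ))
      (𝓝 (-1 * ∫ u in Set.Ioo (movePair x j ξ ξ k) (movePair x j ξ ξ (k + 1)),
        f u * coulombWeight n (dropPair x j) u)) := by
  have hj := h.one_le
  have hj' := h.le
  have hkn : k ∈ Finset.Icc 1 (2 * n - 1) := Finset.mem_Icc.2 (by omega)
  have hcell (p : ℝ × ℝ) :
      cellIntegral (n + 1) (movePair x j p.1 p.2) k (fun u => (u - p.1) * f u) =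
      ∫ u in Set.Ioo (movePair x j p.1 p.2 k) (movePair x j p.1 p.2 (k + 1)),
        (u - p.1) * (|u - p.1| ^ (-(2 : ℝ)⁻¹) * |u - p.2| ^ (-(2 : ℝ)⁻¹)) *
          (f u * coulombWeight n (dropPair x j) u) := by
    refine integral_congr_ae (Eventually.of_forall fun u => ?_)
    simp only [coulombWeight_movePair hj hj']
    ring
  simp only [hcell]
  have hlow (s t : ℝ) : dropPair x j k = movePair x j s t k := by
    rw [movePair_of_ne x s t (by omega) (by omega), dropPair, if_pos hkj]
  have hup : movePair x j ξ ξ (k + 1) ≤ ξ ∧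
      movePair x j ξ ξ (k + 1) ≤ dropPair x j (k + 1) := by
    by_cases hk2 : k + 1 < j
    · rw [movePair_of_ne x ξ ξ (by omega) (by omega), dropPair, if_pos hk2]
      exact ⟨(h.lo _ (by omega) hk2).le, le_rfl⟩
    · obtain rfl : k + 1 = j := by omega
      rw [movePair_left, dropPair, if_neg (lt_irrefl _)]
      exact ⟨le_rfl, (h.hi _ (by omega) (by omega)).le⟩
  have hup' (p : ℝ × ℝ) (hp : p ∈ pairDomain n j x) : movePair x j p.1 p.2 (k + 1) ≤ p.1 ∧
      movePair x j p.1 p.2 (k + 1) ≤ dropPair x j (k + 1) := by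
    by_cases hk2 : k + 1 < j
    · rw [movePair_of_ne x p.1 p.2 (by omega) (by omega), dropPair, if_pos hk2]
      exact ⟨(hp.2.1 _ (by omega) hk2).le, le_rfl⟩
    · obtain rfl : k + 1 = j := by omega
      rw [movePair_left, dropPair, if_neg (lt_irrefl _)]
      exact ⟨le_rfl, hp.1.le.trans (hp.2.2 _ (by omega) (by omega)).le⟩
  refine tendsto_setIntegral_Ioo_mul
    (integrableOn_mul_coulombWeight h.isChamber_dropPair hkn hf)
    (tendsto_movePair n j x ξ k) (tendsto_movePair n j x ξ (k + 1)) (hlow ξ ξ).le hup.2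
    (Eventually.of_forall fun p => (hlow p.1 p.2).le) ?_ (fun p => by fun_prop) ?_ ?_
  · filter_upwards [self_mem_nhdsWithin] with p hp using (hup' p hp).2
  · filter_upwards [self_mem_nhdsWithin] with p hp u hu
    have h1 := hu.2.trans_le (hup' p hp).1
    have h2 := hp.1
    refine abs_collapse_le_one (sub_ne_zero.2 h1.ne) ?_
    rw [abs_of_neg (sub_neg.2 h1), abs_of_neg (sub_neg.2 (h1.trans h2))]
    linarith
  · intro u hu
    have h1 := sub_neg.2 (hu.2.trans_le hup.1)
    have := tendsto_collapse h1.ne ((tendsto_fst n j x ξ).const_sub u)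
      ((tendsto_snd n j x ξ).const_sub u)
    rwa [abs_of_neg h1, div_neg, div_self h1.ne] at this

theorem tendsto_cellIntegral_of_gt (h : PairCollision n j x ξ) {f : ℝ → ℝ} (hf : Continuous f)
    {k : ℕ} (hkj : j < k) (hkn : k ≤ 2 * n + 1) (hk : j + 1 < k ∨ 2 ≤ j) :
    Tendsto (fun p : ℝ × ℝ =>
      cellIntegral (n + 1) (movePair x j p.1 p.2) k fun u => (u - p.1) * f u)
      (𝓝[pairDomain n j x] (ξ, ξ))
      (𝓝 (1 * ∫ u in Set.Ioo (movePair x j ξ ξ k) (movePair x j ξ ξ (k + 1)),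
        f u * coulombWeight n (dropPair x j) u)) := by
  have hj := h.one_le
  have hj' := h.le
  have hcell (p : ℝ × ℝ) :
      cellIntegral (n + 1) (movePair x j p.1 p.2) k (fun u => (u - p.2) * f u) =
      ∫ u in Set.Ioo (movePair x j p.1 p.2 k) (movePair x j p.1 p.2 (k + 1)),
        (u - p.2) * (|u - p.2| ^ (-(2 : ℝ)⁻¹) * |u - p.1| ^ (-(2 : ℝ)⁻¹)) *
          (f u * coulombWeight n (dropPair x j) u) := by
    refine integral_congr_ae (Eventually.of_forall fun u => ?_)
    simp only [coulombWeight_movePair hj hj']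
    ring
  have hhigh (s t : ℝ) : movePair x j s t (k + 1) = dropPair x j (k - 2 + 1) := by
    rw [movePair_of_ne x s t (by omega) (by omega), dropPair, if_neg (by omega)]
    congr 1
    omega
  have hlow : ξ ≤ movePair x j ξ ξ k ∧ dropPair x j (k - 2) ≤ movePair x j ξ ξ k := by
    by_cases hk2 : j + 1 < k
    · rw [movePair_of_ne x ξ ξ (by omega) (by omega), dropPair, if_neg (by omega),
        Nat.sub_add_cancel (by omega)]
      exact ⟨(h.hi _ hk2 (by omega)).le, le_rfl⟩
    · obtain rfl : k = j + 1 := by omega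
      rw [movePair_right, dropPair, if_pos (by omega)]
      exact ⟨le_rfl, (h.lo _ (by omega) (by omega)).le⟩
  have hlow' (p : ℝ × ℝ) (hp : p ∈ pairDomain n j x) : p.2 ≤ movePair x j p.1 p.2 k ∧
      dropPair x j (k - 2) ≤ movePair x j p.1 p.2 k := by
    by_cases hk2 : j + 1 < k
    · rw [movePair_of_ne x p.1 p.2 (by omega) (by omega), dropPair, if_neg (by omega),
        Nat.sub_add_cancel (by omega)]
      exact ⟨(hp.2.2 _ hk2 (by omega)).le, le_rfl⟩
    · obtain rfl : k = j + 1 := by omega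
      rw [movePair_right, dropPair, if_pos (by omega)]
      exact ⟨le_rfl, (hp.2.1 _ (by omega) (by omega)).le.trans hp.1.le⟩
  have hmain : Tendsto (fun p : ℝ × ℝ =>
      cellIntegral (n + 1) (movePair x j p.1 p.2) k fun u => (u - p.2) * f u)
      (𝓝[pairDomain n j x] (ξ, ξ))
      (𝓝 (1 * ∫ u in Set.Ioo (movePair x j ξ ξ k) (movePair x j ξ ξ (k + 1)),
        f u * coulombWeight n (dropPair x j) u)) := by
    simp only [hcell]
    refine tendsto_setIntegral_Ioo_mul
      (integrableOn_mul_coulombWeight h.isChamber_dropPair (k := k - 2)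
        (Finset.mem_Icc.2 (by omega)) hf)
      (tendsto_movePair n j x ξ k) (tendsto_movePair n j x ξ (k + 1)) hlow.2 (hhigh ξ ξ).le
      ?_ (Eventually.of_forall fun p => (hhigh p.1 p.2).le) (fun p => by fun_prop) ?_ ?_
    · filter_upwards [self_mem_nhdsWithin] with p hp using (hlow' p hp).2
    · filter_upwards [self_mem_nhdsWithin] with p hp u hu
      have h1 := (hlow' p hp).1.trans_lt hu.1
      have h2 := hp.1
      refine abs_collapse_le_one (sub_ne_zero.2 h1.ne') ?_
      rw [abs_of_pos (sub_pos.2 h1), abs_of_pos (sub_pos.2 (h2.trans h1))]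
      linarith
    · intro u hu
      have h1 := sub_pos.2 (hlow.1.trans_lt hu.1)
      have := tendsto_collapse h1.ne' ((tendsto_snd n j x ξ).const_sub u)
        ((tendsto_fst n j x ξ).const_sub u)
      rwa [abs_of_pos h1, div_self h1.ne'] at this
  have hcorr := (tendsto_gap_rpow n j x ξ (e := 1 / 4) (by norm_num)).mul
    (h.tendsto_gap_mul_cellIntegral hf (k := k) (Finset.mem_Icc.2 (by omega)) hkj.ne')
  have hsum := hmain.add hcorr
  rw [mul_zero, add_zero] at hsum
  refine hsum.congr' ?_
  filter_upwards [self_mem_nhdsWithin] with p hp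
  have hpos : 0 < p.2 - p.1 := sub_pos.2 hp.1
  have hc := h.isChamber_movePair hp
  have hkc : k ∈ Finset.Icc 1 (2 * (n + 1) - 1) := Finset.mem_Icc.2 (by omega)
  rw [← mul_assoc, ← Real.rpow_add hpos,
    show (1 / 4 : ℝ) + 3 / 4 = 1 by norm_num, Real.rpow_one]
  simp only [cellIntegral]
  rw [← integral_const_mul, ← integral_add
    (integrableOn_mul_coulombWeight hc hkc (f := fun u => (u - p.2) * f u) (by fun_prop))
    ((integrableOn_mul_coulombWeight hc hkc hf).const_mul _)]
  refine integral_congr_ae (Eventually.of_forall fun u => ?_)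
  ring

theorem cellIntegral_eq_add (h : PairCollision n j x ξ) {f : ℝ → ℝ} (hf : Continuous f)
    (hj1 : 2 ≤ j) (hj2 : j ≤ 2 * n) :
    cellIntegral n (dropPair x j) (j - 1) f =
      (∫ u in Set.Ioo (x (j - 1)) ξ, f u * coulombWeight n (dropPair x j) u) +
      ∫ u in Set.Ioo ξ (x (j + 2)), f u * coulombWeight n (dropPair x j) u := by
  have hint := integrableOn_mul_coulombWeight h.isChamber_dropPair (k := j - 1)
    (Finset.mem_Icc.2 (by omega)) hf
  have e1 : dropPair x j (j - 1) = x (j - 1) := by rw [dropPair, if_pos (by omega)]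
  have e2 : dropPair x j (j - 1 + 1) = x (j + 2) := by
    rw [dropPair, if_neg (by omega), Nat.sub_add_cancel (by omega)]
  have h1 := h.lo (j - 1) (by omega) (by omega)
  have h2 := h.hi (j + 2) (by omega) (by omega)
  rw [cellIntegral]
  rw [e1, e2] at hint ⊢
  simp only [← integral_Ioc_eq_integral_Ioo]
  rw [← intervalIntegral.integral_of_le h1.le, ← intervalIntegral.integral_of_le h2.le,
    ← intervalIntegral.integral_of_le (h1.trans h2).le,
    intervalIntegral.integral_add_adjacent_intervals]
  · exact (intervalIntegrable_iff_integrableOn_Ioo_of_le h1.le).2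
      (hint.mono_set (Set.Ioo_subset_Ioo_right h2.le))
  · exact (intervalIntegrable_iff_integrableOn_Ioo_of_le h2.le).2
      (hint.mono_set (Set.Ioo_subset_Ioo_left h1.le))

/-- The sign picked up by the cell `k` when the pair `x_j, x_{j+1}` is removed. -/
def cellSign (j k : ℕ) : ℝ := if k < j then -1 else if k = j then 0 else 1

theorem tendsto_cellIntegral_sub (h : PairCollision n j x ξ) {f : ℝ → ℝ} (hf : Continuous f)
    {k : ℕ} (hk : k ∈ Finset.Icc 1 (2 * n + 1)) (hlt : k + 1 = j → j ≤ 2 * n)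
    (hgt : k = j + 1 → 2 ≤ j) :
    Tendsto (fun p : ℝ × ℝ =>
      cellIntegral (n + 1) (movePair x j p.1 p.2) k fun u => (u - p.1) * f u)
      (𝓝[pairDomain n j x] (ξ, ξ))
      (𝓝 (cellSign j k * ∫ u in Set.Ioo (movePair x j ξ ξ k) (movePair x j ξ ξ (k + 1)),
        f u * coulombWeight n (dropPair x j) u)) := by
  rw [Finset.mem_Icc] at hk
  rcases lt_trichotomy k j with hkj | rfl | hkj
  · rw [cellSign, if_pos hkj]
    exact h.tendsto_cellIntegral_of_lt hf hk.1 hkj (by omega)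
  · rw [cellSign, if_neg (lt_irrefl _), if_pos rfl, zero_mul]
    have hlim := (tendsto_gap_rpow n k x ξ (e := 3 / 4) (by norm_num)).mul
      (h.tendsto_cellIntegral_self_sub hf)
    rw [mul_zero] at hlim
    refine hlim.congr' ?_
    filter_upwards [self_mem_nhdsWithin] with p hp
    rw [← mul_assoc, ← Real.rpow_add (sub_pos.2 hp.1), add_neg_cancel, Real.rpow_zero, one_mul]
  · rw [cellSign, if_neg hkj.not_gt, if_neg hkj.ne']
    exact h.tendsto_cellIntegral_of_gt hf hkj hk.2 (by omega)

theorem sum_cellSign_eq (h : PairCollision n j x ξ) {f : ℝ → ℝ} (hf : Continuous f)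
    {a b : ℕ} (ha : 1 ≤ a) (hab : a < b) (hb : b ≤ 2 * (n + 1)) (haj : a ≠ j) (haj' : a ≠ j + 1)
    (hbj : b ≠ j) (hbj' : b ≠ j + 1) :
    ∑ k ∈ Finset.Ico a b, Complex.I ^ k * ((cellSign j k *
      ∫ u in Set.Ioo (movePair x j ξ ξ k) (movePair x j ξ ξ (k + 1)),
        f u * coulombWeight n (dropPair x j) u : ℝ) : ℂ) =
    -∑ k ∈ Finset.Ico (relabelIdx j a) (relabelIdx j b),
      Complex.I ^ k * (cellIntegral n (dropPair x j) k f : ℂ) := by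
  set T : ℕ → ℂ := fun k => Complex.I ^ k * ((cellSign j k *
      ∫ u in Set.Ioo (movePair x j ξ ξ k) (movePair x j ξ ξ (k + 1)),
        f u * coulombWeight n (dropPair x j) u : ℝ) : ℂ) with hT
  set C : ℕ → ℂ := fun k => Complex.I ^ k * (cellIntegral n (dropPair x j) k f : ℂ) with hC
  have hleft (k : ℕ) (hk : k + 1 < j) : T k = -C k := by
    simp only [hT, hC, cellSign, cellIntegral, dropPair]
    rw [if_pos (by omega), movePair_of_ne x ξ ξ (by omega) (by omega),
      movePair_of_ne x ξ ξ (by omega) (by omega), if_pos (by omega), if_pos hk]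
    push_cast
    ring
  have hright (k : ℕ) (hk : j ≤ k) : T (k + 2) = -C k := by
    simp only [hT, hC, cellSign, cellIntegral, dropPair]
    rw [if_neg (by omega), if_neg (by omega), movePair_of_ne x ξ ξ (by omega) (by omega),
      movePair_of_ne x ξ ξ (by omega) (by omega), if_neg (by omega), if_neg (by omega),
      show k + 2 + 1 = k + 1 + 2 by ring, pow_add, Complex.I_sq]
    push_cast
    ring
  rw [← Finset.sum_neg_distrib]
  rcases lt_or_gt_of_ne hbj with hb1 | hb1
  · rw [relabelIdx, relabelIdx, if_pos (by omega), if_pos hb1]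
    exact Finset.sum_congr rfl fun k hk => hleft k (by have := (Finset.mem_Ico.1 hk).2; omega)
  rcases lt_or_gt_of_ne haj with ha1 | ha1
  · obtain ⟨i, rfl⟩ : ∃ i, j = i + 1 := ⟨j - 1, by omega⟩
    obtain ⟨c, rfl⟩ : ∃ c, b = c + 2 := ⟨b - 2, by omega⟩
    rw [relabelIdx, relabelIdx, if_pos ha1, if_neg (by omega), Nat.add_sub_cancel]
    have hmid : T i + T (i + 1) + T (i + 2) = -C i := by
      have hadd := h.cellIntegral_eq_add hf (by omega) (by omega)
      rw [Nat.add_sub_cancel] at hadd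
      have e1 : movePair x (i + 1) ξ ξ i = x i := movePair_of_ne x ξ ξ (by omega) (by omega)
      have e2 : movePair x (i + 1) ξ ξ (i + 1) = ξ := movePair_left _ _ _ _
      have e3 : movePair x (i + 1) ξ ξ (i + 2) = ξ := movePair_right _ _ _ _
      have e4 : movePair x (i + 1) ξ ξ (i + 2 + 1) = x (i + 1 + 2) :=
        movePair_of_ne x ξ ξ (by omega) (by omega)
      simp only [hT, hC, hadd, cellSign, e1, e2, e3, e4]
      rw [if_pos (by omega), if_neg (by omega), if_pos trivial, if_neg (by omega), if_neg (by omega),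
        pow_add _ i 2, Complex.I_sq]
      push_cast
      ring
    rw [← Finset.sum_Ico_consecutive T (show a ≤ i by omega) (show i ≤ c + 2 by omega),
      ← Finset.sum_Ico_consecutive T (show i ≤ i + 3 by omega) (show i + 3 ≤ c + 2 by omega),
      ← Finset.sum_Ico_consecutive (fun k => -C k) (show a ≤ i by omega) (show i ≤ c by omega),
      Finset.sum_eq_sum_Ico_succ_bot (show i < c by omega)]
    congr 1
    · exact Finset.sum_congr rfl fun k hk =>
        hleft k (by have := (Finset.mem_Ico.1 hk).2; omega)
    congr 1
    · rw [← hmid, Finset.sum_Ico_eq_sum_range]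
      simp [Finset.sum_range_succ]
    · rw [show i + 3 = i + 1 + 2 by ring, ← Finset.sum_Ico_add']
      exact Finset.sum_congr rfl fun k hk => hright k (Finset.mem_Ico.1 hk).1
  · obtain ⟨d, rfl⟩ : ∃ d, a = d + 2 := ⟨a - 2, by omega⟩
    obtain ⟨c, rfl⟩ : ∃ c, b = c + 2 := ⟨b - 2, by omega⟩
    rw [relabelIdx, relabelIdx, if_neg (by omega), if_neg (by omega), Nat.add_sub_cancel,
      Nat.add_sub_cancel, ← Finset.sum_Ico_add']
    exact Finset.sum_congr rfl fun k hk =>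
      hright k (by have := (Finset.mem_Ico.1 hk).1; omega)

theorem tendsto_sum_cellIntegral_sub (h : PairCollision n j x ξ) {f : ℝ → ℝ}
    (hf : Continuous f) {a b : ℕ} (ha : 1 ≤ a) (hab : a < b) (hb : b ≤ 2 * (n + 1))
    (haj : a ≠ j) (haj' : a ≠ j + 1) (hbj : b ≠ j) (hbj' : b ≠ j + 1) :
    Tendsto (fun p : ℝ × ℝ => ∑ k ∈ Finset.Ico a b, Complex.I ^ k *
      (cellIntegral (n + 1) (movePair x j p.1 p.2) k (fun u => (u - p.1) * f u) : ℂ))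
      (𝓝[pairDomain n j x] (ξ, ξ))
      (𝓝 (-∑ k ∈ Finset.Ico (relabelIdx j a) (relabelIdx j b),
        Complex.I ^ k * (cellIntegral n (dropPair x j) k f : ℂ))) := by
  rw [← h.sum_cellSign_eq hf ha hab hb haj haj' hbj hbj']
  refine tendsto_finsetSum _ fun k hk => Tendsto.const_mul _ ?_
  rw [Finset.mem_Ico] at hk
  exact (Complex.continuous_ofReal.tendsto _).comp
    (h.tendsto_cellIntegral_sub hf (Finset.mem_Icc.2 (by omega)) (by omega) (by omega))

theorem tendsto_gap_mul_sum_cellIntegral (h : PairCollision n j x ξ) {f : ℝ → ℝ}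
    (hf : Continuous f) {a b : ℕ} (ha : 1 ≤ a) (hb : b ≤ 2 * (n + 1)) :
    Tendsto (fun p : ℝ × ℝ => (((p.2 - p.1) ^ (3 / 4 : ℝ) : ℝ) : ℂ) *
      ∑ k ∈ Finset.Ico a b, Complex.I ^ k *
        (cellIntegral (n + 1) (movePair x j p.1 p.2) k f : ℂ))
      (𝓝[pairDomain n j x] (ξ, ξ)) (𝓝 0) := by
  have hcell (k : ℕ) (hk : k ∈ Finset.Ico a b) : Tendsto (fun p : ℝ × ℝ =>
      (p.2 - p.1) ^ (3 / 4 : ℝ) * cellIntegral (n + 1) (movePair x j p.1 p.2) k f)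
      (𝓝[pairDomain n j x] (ξ, ξ)) (𝓝 0) := by
    rw [Finset.mem_Ico] at hk
    by_cases hkj : k = j
    · subst hkj
      have := (tendsto_gap_rpow n k x ξ (e := 3 / 4) (by norm_num)).mul
        (h.tendsto_cellIntegral_self hf)
      rwa [zero_mul] at this
    · exact h.tendsto_gap_mul_cellIntegral hf (Finset.mem_Icc.2 (by omega)) hkj
  have hsum : Tendsto (fun p : ℝ × ℝ => ∑ k ∈ Finset.Ico a b, Complex.I ^ k *
      (((p.2 - p.1) ^ (3 / 4 : ℝ) * cellIntegral (n + 1) (movePair x j p.1 p.2) k f : ℝ) : ℂ))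
      (𝓝[pairDomain n j x] (ξ, ξ))
      (𝓝 (∑ k ∈ Finset.Ico a b, Complex.I ^ k * ((0 : ℝ) : ℂ))) :=
    tendsto_finsetSum _ fun k hk => Tendsto.const_mul _
      ((Complex.continuous_ofReal.tendsto _).comp (hcell k hk))
  simp only [Complex.ofReal_zero, mul_zero, Finset.sum_const_zero] at hsum
  refine hsum.congr fun p => ?_
  rw [Finset.mul_sum]
  refine Finset.sum_congr rfl fun k _ => ?_
  push_cast
  ring

end PairCollision

theorem prod_ite_castSucc_lt {n : ℕ} (r : Fin (n + 1)) (c : ℂ) :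
    ∏ s : Fin n, (if s.castSucc < r then c else 1) = c ^ (r : ℕ) := by
  rw [Finset.prod_ite, Finset.prod_const, Finset.prod_const_one, mul_one]
  congr 1
  have := Fin.card_filter_val_lt (n := n) (m := (r : ℕ))
  simp only [Fin.lt_def, Fin.val_castSucc]
  rw [this]
  omega

theorem IsReduction.I_zpow_eq {n : ℕ} {β : LinkPattern (n + 1)} {j : ℕ} {γ : LinkPattern n}
    (hγ : IsReduction (n + 1) β j γ) {r₀ : Fin (n + 1)} (ha : β.a r₀ = j)
    (hb : β.b r₀ = j + 1) :
    Complex.I ^ (-∑ r, (β.a r : ℤ)) * ((-1) ^ (r₀ : ℕ) * Complex.I ^ j * (-1) ^ n) =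
      Complex.I ^ (-∑ s, (γ.a s : ℤ)) := by
  have hzpow {N : ℕ} (a : Fin N → ℕ) :
      Complex.I ^ (-∑ r, (a r : ℤ)) = ∏ r, (Complex.I ^ a r)⁻¹ := by
    rw [zpow_neg, ← Nat.cast_sum, zpow_natCast, Finset.prod_inv_distrib, Finset.prod_pow_eq_pow_sum]
  have hn : ((-1 : ℂ)) ^ n = ∏ _s : Fin n, (-1 : ℂ) := by simp
  rw [hzpow, hzpow, Fin.prod_univ_succAbove _ r₀, ha, ← prod_ite_castSucc_lt r₀ (-1), hn]
  have hI : Complex.I ^ j ≠ 0 := pow_ne_zero _ Complex.I_ne_zero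
  have hterm (s : Fin n) : (Complex.I ^ β.a (r₀.succAbove s))⁻¹ *
      ((if s.castSucc < r₀ then (-1 : ℂ) else 1) * -1) = (Complex.I ^ γ.a s)⁻¹ := by
    obtain ⟨h1, h2, -, -⟩ := β.endpoints_ne ha hb (r₀.succAbove_ne s)
    rw [hγ.a_eq ha hb]
    dsimp only
    by_cases hs : s.castSucc < r₀
    · have hlt : β.a (r₀.succAbove s) < j := by
        rw [← ha, β.a_mono.lt_iff_lt, Fin.succAbove_of_castSucc_lt _ _ hs]
        exact hs
      rw [relabelIdx, if_pos hs, if_pos hlt]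
      ring
    · have hlt : j < β.a (r₀.succAbove s) := by
        rw [← ha, β.a_mono.lt_iff_lt, Fin.succAbove_of_le_castSucc _ _ (not_lt.1 hs)]
        exact Fin.lt_def.2 (Nat.lt_succ_of_le (Fin.le_def.1 (not_lt.1 hs)))
      obtain ⟨d, hd⟩ : ∃ d, β.a (r₀.succAbove s) = d + 2 := ⟨β.a (r₀.succAbove s) - 2, by omega⟩
      rw [relabelIdx, if_neg hs, if_neg hlt.not_gt, hd, Nat.add_sub_cancel, pow_add, Complex.I_sq,
        mul_neg_one, inv_neg]
      ring
  rw [← Finset.prod_congr rfl fun s _ => hterm s, Finset.prod_mul_distrib,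
    Finset.prod_mul_distrib]
  field_simp

/-- The determinant of a matrix whose row `r₀` and column `0` meet in their only nonzero entry. -/
theorem det_eq_of_row_col_eq_zero {n : ℕ} (L : Matrix (Fin (n + 1)) (Fin (n + 1)) ℂ)
    (r₀ : Fin (n + 1)) (hrow : ∀ m : Fin n, L r₀ m.succ = 0) :
    L.det = (-1) ^ (r₀ : ℕ) * L r₀ 0 * (L.submatrix r₀.succAbove Fin.succ).det := by
  rw [Matrix.det_succ_row L r₀, Fin.sum_univ_succ]
  simp [hrow]

theorem det_scale_row_col {n : ℕ} (M : Matrix (Fin (n + 1)) (Fin (n + 1)) ℂ) (r₀ : Fin (n + 1))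
    {c d : ℂ} (hcd : c * d = 1) :
    (Matrix.of fun r m => (if r = r₀ then c else 1) * ((if m = 0 then d else 1) * M r m)).det =
      M.det := by
  have h1 := Matrix.det_mul_column (fun r : Fin (n + 1) => if r = r₀ then c else 1)
    (Matrix.of fun r m => (if m = 0 then d else 1) * M r m)
  have h2 := Matrix.det_mul_row (fun m : Fin (n + 1) => if m = 0 then d else 1) M
  rw [h2] at h1
  simp only [Finset.prod_ite_eq', Finset.mem_univ, if_true, ← mul_assoc, hcd, one_mul] at h1
  simpa only [Matrix.of_apply, ← mul_assoc] using h1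

/-- The monic polynomials `1, X - s, (X - s) X, (X - s) X², …`. -/
noncomputable def shiftPoly {n : ℕ} (s : ℝ) : Fin (n + 1) → Polynomial ℝ :=
  Fin.cons 1 fun m : Fin n => (Polynomial.X - Polynomial.C s) * Polynomial.X ^ (m : ℕ)

theorem shiftPoly_monic {n : ℕ} (s : ℝ) (m : Fin (n + 1)) : (shiftPoly s m).Monic := by
  cases m using Fin.cases with
  | zero => exact Polynomial.monic_one
  | succ m => exact (Polynomial.monic_X_sub_C s).mul (Polynomial.monic_X_pow _)

theorem natDegree_shiftPoly {n : ℕ} (s : ℝ) (m : Fin (n + 1)) :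
    (shiftPoly s m).natDegree = m := by
  cases m using Fin.cases with
  | zero => simp [shiftPoly]
  | succ m =>
    rw [shiftPoly, Fin.cons_succ, (Polynomial.monic_X_sub_C s).natDegree_mul
      (Polynomial.monic_X_pow _), Polynomial.natDegree_X_sub_C, Polynomial.natDegree_X_pow,
      Fin.val_succ, add_comm]

namespace PairCollision

variable {n j : ℕ} {x : ℕ → ℝ} {ξ : ℝ}

theorem tendsto_det (h : PairCollision n j x ξ) {β : LinkPattern (n + 1)} {γ : LinkPattern n}
    (hγ : IsReduction (n + 1) β j γ) {r₀ : Fin (n + 1)} (ha : β.a r₀ = j)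
    (hb : β.b r₀ = j + 1) :
    Tendsto (fun p : ℝ × ℝ => (Matrix.of fun r m => ∑ k ∈ Finset.Ico (β.a r) (β.b r),
        Complex.I ^ k * (cellIntegral (n + 1) (movePair x j p.1 p.2) k
          fun u => (shiftPoly p.1 m).eval u : ℂ)).det)
      (𝓝[pairDomain n j x] (ξ, ξ))
      (𝓝 ((-1) ^ (r₀ : ℕ) * Complex.I ^ j * (-1) ^ n *
        ((Real.pi * coulombWeight n (dropPair x j) ξ : ℝ) : ℂ) *
        (Matrix.of fun s m : Fin n => ∑ k ∈ Finset.Ico (γ.a s) (γ.b s),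
          Complex.I ^ k * (cellIntegral n (dropPair x j) k
            fun u => (Polynomial.X ^ (m : ℕ) : Polynomial ℝ).eval u : ℂ)).det)) := by
  set M : ℝ × ℝ → Matrix (Fin (n + 1)) (Fin (n + 1)) ℂ := fun p =>
    Matrix.of fun r m => ∑ k ∈ Finset.Ico (β.a r) (β.b r),
        Complex.I ^ k * (cellIntegral (n + 1) (movePair x j p.1 p.2) k
          fun u => (shiftPoly p.1 m).eval u : ℂ) with hM
  set E : Matrix (Fin n) (Fin n) ℂ := Matrix.of fun s m => ∑ k ∈ Finset.Ico (γ.a s) (γ.b s),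
          Complex.I ^ k * (cellIntegral n (dropPair x j) k
            fun u => (Polynomial.X ^ (m : ℕ) : Polynomial ℝ).eval u : ℂ) with hE
  set w : ℂ := ((Real.pi * coulombWeight n (dropPair x j) ξ : ℝ) : ℂ) with hw
  let L : Matrix (Fin (n + 1)) (Fin (n + 1)) ℂ :=
    r₀.insertNth (Fin.cons (Complex.I ^ j * w) fun _ => 0) fun s => Fin.cons 0 fun m => -E s m
  have hdet : L.det = (-1) ^ (r₀ : ℕ) * Complex.I ^ j * (-1) ^ n * w * E.det := by
    have hsub : L.submatrix r₀.succAbove Fin.succ = -E := by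
      ext s m
      rw [Matrix.submatrix_apply]
      simp [L]
    rw [det_eq_of_row_col_eq_zero L r₀ (fun m => by simp [L]), hsub, Matrix.det_neg,
      Fintype.card_fin]
    simp only [L, Fin.insertNth_apply_same, Fin.cons_zero]
    ring
  have hself (p : ℝ × ℝ) (m : Fin (n + 1)) : M p r₀ m = Complex.I ^ j *
      (cellIntegral (n + 1) (movePair x j p.1 p.2) j fun u => (shiftPoly p.1 m).eval u : ℂ) := by
    simp only [hM, Matrix.of_apply, ha, hb, Nat.Ico_succ_singleton, Finset.sum_singleton]
  have hzero (s : ℝ) : (fun u => (shiftPoly (n := n) s 0).eval u) = fun _ => (1 : ℝ) := by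
    funext u
    simp [shiftPoly]
  have hsucc (s : ℝ) (m : Fin n) : (fun u => (shiftPoly s m.succ).eval u) =
      fun u => (u - s) * u ^ (m : ℕ) := by
    funext u
    simp [shiftPoly]
  have hentry : Tendsto (fun p : ℝ × ℝ => Matrix.of fun r m =>
      (if r = r₀ then (((p.2 - p.1) ^ (-(3 / 4) : ℝ) : ℝ) : ℂ) else 1) *
        ((if m = 0 then (((p.2 - p.1) ^ (3 / 4 : ℝ) : ℝ) : ℂ) else 1) * M p r m))
      (𝓝[pairDomain n j x] (ξ, ξ)) (𝓝 L) := by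
    refine tendsto_pi_nhds.2 fun r => tendsto_pi_nhds.2 fun m => ?_
    simp only [Matrix.of_apply]
    rcases Fin.eq_self_or_eq_succAbove r₀ r with rfl | ⟨s, rfl⟩
    · simp only [if_true, hself]
      cases m using Fin.cases with
      | zero =>
        have hlim := ((Complex.continuous_ofReal.tendsto _).comp
          (h.tendsto_cellIntegral_self (continuous_const (y := (1 : ℝ))))).const_mul
            (Complex.I ^ j)
        have hL : L r 0 = Complex.I ^ j *
            ((Real.pi * (1 * coulombWeight n (dropPair x j) ξ) : ℝ) : ℂ) := by
          simp [L, hw]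
        rw [hL]
        refine hlim.congr' ?_
        filter_upwards [self_mem_nhdsWithin] with p hp
        have hε := Real.rpow_add (sub_pos.2 hp.1) (-(3 / 4)) (3 / 4)
        rw [neg_add_cancel, Real.rpow_zero] at hε
        rw [if_pos rfl, hzero, ← mul_assoc, ← Complex.ofReal_mul, ← hε, Complex.ofReal_one,
          one_mul]
        rfl
      | succ m =>
        have hlim := ((Complex.continuous_ofReal.tendsto _).comp
          (h.tendsto_cellIntegral_self_sub (continuous_pow (m : ℕ)))).const_mul (Complex.I ^ j)
        have hL : L r m.succ = Complex.I ^ j * ((0 : ℝ) : ℂ) := by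
          simp [L]
        rw [hL]
        refine hlim.congr fun p => ?_
        rw [if_neg (Fin.succ_ne_zero m), hsucc, Function.comp_apply, Complex.ofReal_mul]
        ring
    · obtain ⟨h1, h2, h3, h4⟩ := β.endpoints_ne ha hb (r₀.succAbove_ne s)
      have ha1 := β.one_le_a (r₀.succAbove s)
      have hb1 := β.b_le (r₀.succAbove s)
      simp only [if_neg (r₀.succAbove_ne s), one_mul, hM, Matrix.of_apply]
      cases m using Fin.cases with
      | zero =>
        have hL : L (r₀.succAbove s) 0 = 0 := by simp [L]
        simp only [hL, hzero, if_true]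
        exact h.tendsto_gap_mul_sum_cellIntegral continuous_const ha1 hb1
      | succ m =>
        have hL : L (r₀.succAbove s) m.succ = -E s m := by simp [L]
        simp only [hL, hsucc, if_neg (Fin.succ_ne_zero m), one_mul, hE, Matrix.of_apply,
          hγ.a_eq ha hb, hγ.b_eq ha hb, Polynomial.eval_pow, Polynomial.eval_X]
        exact h.tendsto_sum_cellIntegral_sub (continuous_pow _) ha1 (β.a_lt_b _) hb1 h1 h2 h3 h4
  rw [← hdet]
  refine ((Continuous.matrix_det continuous_id).tendsto L |>.comp hentry).congr' ?_
  filter_upwards [self_mem_nhdsWithin] with p hp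
  refine det_scale_row_col (M p) r₀ ?_
  rw [← Complex.ofReal_mul, ← Real.rpow_add (sub_pos.2 hp.1), neg_add_cancel, Real.rpow_zero,
    Complex.ofReal_one]

theorem tendsto_coulomb (h : PairCollision n j x ξ) {β : LinkPattern (n + 1)}
    {γ : LinkPattern n} (hγ : IsReduction (n + 1) β j γ) {r₀ : Fin (n + 1)} (ha : β.a r₀ = j)
    (hb : β.b r₀ = j + 1) :
    Tendsto (fun p : ℝ × ℝ => coulomb (n + 1) β (movePair x j p.1 p.2) /
        (((p.2 - p.1) ^ ((4 : ℝ)⁻¹) : ℝ) : ℂ))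
      (𝓝[pairDomain n j x] (ξ, ξ)) (𝓝 (Real.pi * coulomb n γ (dropPair x j))) := by
  have hW : coulombWeight n (dropPair x j) ξ ≠ 0 := Finset.prod_ne_zero_iff.2 fun i hi =>
    (Real.rpow_pos_of_pos (abs_pos.2 (h.ne_dropPair hi)) _).ne'
  have hlim := (((Complex.continuous_ofReal.tendsto _).comp h.tendsto_gapProduct).mul_const
    (Complex.I ^ (-∑ r, (β.a r : ℤ)))).mul (h.tendsto_det hγ ha hb)
  have hval : (Real.pi : ℂ) * coulomb n γ (dropPair x j) =
      (((coulombWeight n (dropPair x j) ξ)⁻¹ * gapProduct n (dropPair x j) : ℝ) : ℂ) *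
        Complex.I ^ (-∑ r, (β.a r : ℤ)) * ((-1) ^ (r₀ : ℕ) * Complex.I ^ j * (-1) ^ n *
        ((Real.pi * coulombWeight n (dropPair x j) ξ : ℝ) : ℂ) *
        (Matrix.of fun s m : Fin n => ∑ k ∈ Finset.Ico (γ.a s) (γ.b s),
          Complex.I ^ k * (cellIntegral n (dropPair x j) k
            fun u => (Polynomial.X ^ (m : ℕ) : Polynomial ℝ).eval u : ℂ)).det) := by
    rw [coulomb_eq_det γ h.isChamber_dropPair (fun m => Polynomial.X ^ (m : ℕ))
      (fun m => Polynomial.natDegree_X_pow _) (fun m => Polynomial.monic_X_pow _),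
      ← hγ.I_zpow_eq ha hb]
    have hW' : (coulombWeight n (dropPair x j) ξ : ℂ) ≠ 0 := Complex.ofReal_ne_zero.2 hW
    push_cast
    field_simp
  rw [hval]
  refine hlim.congr' ?_
  filter_upwards [self_mem_nhdsWithin] with p hp
  rw [coulomb_eq_det β (h.isChamber_movePair hp) (shiftPoly p.1) (natDegree_shiftPoly p.1)
    (shiftPoly_monic p.1), Function.comp_apply, Complex.ofReal_div]
  ring

end PairCollision

end

/-- **Asymptotics of `F_β` when `{j,j+1} ∈ β`**: as `x_j, x_{j+1} → ξ`,
`F_β(x)/(x_{j+1}−x_j)^{1/4} → π · F_{β/{j,j+1}}(ẍ_j)`. -/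
theorem coulomb_asymptotics_link (N : ℕ) (hN : 1 ≤ N) (β : LinkPattern N) (j : ℕ)
    (hj1 : 1 ≤ j) (hj2 : j ≤ 2 * N - 1) (hlink : β.Linked j (j + 1))
    (x : ℕ → ℝ) (ξ : ℝ)
    (hx : ∀ i k : ℕ, 1 ≤ i → i < k → k ≤ 2 * N →
      i ≠ j → i ≠ j + 1 → k ≠ j → k ≠ j + 1 → x i < x k)
    (hξlo : ∀ i : ℕ, 1 ≤ i → i < j → x i < ξ)
    (hξhi : ∀ k : ℕ, j + 1 < k → k ≤ 2 * N → ξ < x k)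
    (γ : LinkPattern (N - 1)) (hγ : IsReduction N β j γ) :
    Filter.Tendsto
      (fun p : ℝ × ℝ =>
        coulomb N β (Function.update (Function.update x j p.1) (j + 1) p.2) /
          (((p.2 - p.1) ^ ((4 : ℝ)⁻¹) : ℝ) : ℂ))
      (nhdsWithin (ξ, ξ) {p : ℝ × ℝ | p.1 < p.2 ∧ (∀ i : ℕ, 1 ≤ i → i < j → x i < p.1) ∧
        ∀ k : ℕ, j + 1 < k → k ≤ 2 * N → p.2 < x k})
      (nhds ((Real.pi : ℂ) * coulomb (N - 1) γ fun i => if i < j then x i else x (i + 2))) := by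
  obtain ⟨n, rfl⟩ : ∃ n, N = n + 1 := ⟨N - 1, by omega⟩
  obtain ⟨r₀, ⟨ha, hb⟩ | ⟨ha, hb⟩⟩ := hlink
  · exact PairCollision.tendsto_coulomb ⟨hj1, by omega, hx, hξlo, hξhi⟩ hγ ha hb
  · have := β.a_lt_b r₀
    omega
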